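/- arXiv:1703.10632 — 3 statements merged into one kernel-verified Lean document; each statement's English description precedes it below -/
import Mathlib

section
/- Let α1, α2 ∈ K, α3 ∈ K with α3 ≠ 0, and let ζ ∈ K satisfy ζ² + ζ + 1 = 0. In 𝒦(α1,α2,α3) set v₊ = a + ζ·b + ζ²·c and v₋ = a + ζ²·b + ζ·c. Then there exists λ ∈ K such that v₊ + λ·v₋² is an invertible element (unit) of 𝒦(α1,α2,α3). -/
noncomputable section

open FreeAlgebra

/-- The defining relations of the algebra `𝒦(α₁, α₂)`: with generators `a = ι K 0`,
`b = ι K 1`, `c = ι K 2`, `y = ι K 3`, the relations are `a² = b² = c² = α₁`,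
`ab + bc + ca = α₂` and `ac + cb + ba = α₂ + y`. -/
inductive KRel (K : Type) [Field K] (α1 α2 : K) :
    FreeAlgebra K (Fin 4) → FreeAlgebra K (Fin 4) → Prop
  | ra : KRel K α1 α2 (ι K (0 : Fin 4) * ι K (0 : Fin 4))
      (algebraMap K (FreeAlgebra K (Fin 4)) α1)
  | rb : KRel K α1 α2 (ι K (1 : Fin 4) * ι K (1 : Fin 4))
      (algebraMap K (FreeAlgebra K (Fin 4)) α1)
  | rc : KRel K α1 α2 (ι K (2 : Fin 4) * ι K (2 : Fin 4))
      (algebraMap K (FreeAlgebra K (Fin 4)) α1)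
  | r1 : KRel K α1 α2
      (ι K (0 : Fin 4) * ι K (1 : Fin 4) + ι K (1 : Fin 4) * ι K (2 : Fin 4) +
        ι K (2 : Fin 4) * ι K (0 : Fin 4))
      (algebraMap K (FreeAlgebra K (Fin 4)) α2)
  | r2 : KRel K α1 α2
      (ι K (0 : Fin 4) * ι K (2 : Fin 4) + ι K (2 : Fin 4) * ι K (1 : Fin 4) +
        ι K (1 : Fin 4) * ι K (0 : Fin 4))
      (algebraMap K (FreeAlgebra K (Fin 4)) α2 + ι K (3 : Fin 4))

/-- The algebra `𝒦(α₁, α₂)`: the quotient of the free algebra `K⟨a,b,c,y⟩` by the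
two-sided ideal generated by the relations above. -/
abbrev KAlg (K : Type) [Field K] (α1 α2 : K) : Type := RingQuot (KRel K α1 α2)

/-- The generator `a` of `𝒦(α₁, α₂)`. -/
def Ka (K : Type) [Field K] (α1 α2 : K) : KAlg K α1 α2 :=
  RingQuot.mkAlgHom K (KRel K α1 α2) (ι K (0 : Fin 4))

/-- The generator `b` of `𝒦(α₁, α₂)`. -/
def Kb (K : Type) [Field K] (α1 α2 : K) : KAlg K α1 α2 :=
  RingQuot.mkAlgHom K (KRel K α1 α2) (ι K (1 : Fin 4))

/-- The generator `c` of `𝒦(α₁, α₂)`. -/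
def Kc (K : Type) [Field K] (α1 α2 : K) : KAlg K α1 α2 :=
  RingQuot.mkAlgHom K (KRel K α1 α2) (ι K (2 : Fin 4))

/-- The generator `y` of `𝒦(α₁, α₂)`. -/
def Ky (K : Type) [Field K] (α1 α2 : K) : KAlg K α1 α2 :=
  RingQuot.mkAlgHom K (KRel K α1 α2) (ι K (3 : Fin 4))

/-- The defining relations of the algebra `𝒦(α₁, α₂, α₃)`: those of `𝒦(α₁, α₂)`
together with `y³ = α₃`. -/
inductive KRel3 (K : Type) [Field K] (α1 α2 α3 : K) :
    FreeAlgebra K (Fin 4) → FreeAlgebra K (Fin 4) → Prop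
  | base {x y : FreeAlgebra K (Fin 4)} : KRel K α1 α2 x y → KRel3 K α1 α2 α3 x y
  | r3 : KRel3 K α1 α2 α3 (ι K (3 : Fin 4) ^ 3) (algebraMap K (FreeAlgebra K (Fin 4)) α3)

/-- The algebra `𝒦(α₁, α₂, α₃) = 𝒦(α₁, α₂)/(y³ - α₃)`. -/
abbrev KAlg3 (K : Type) [Field K] (α1 α2 α3 : K) : Type := RingQuot (KRel3 K α1 α2 α3)

/-- The generator `a` of `𝒦(α₁, α₂, α₃)`. -/
def K3a (K : Type) [Field K] (α1 α2 α3 : K) : KAlg3 K α1 α2 α3 :=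
  RingQuot.mkAlgHom K (KRel3 K α1 α2 α3) (ι K (0 : Fin 4))

/-- The generator `b` of `𝒦(α₁, α₂, α₃)`. -/
def K3b (K : Type) [Field K] (α1 α2 α3 : K) : KAlg3 K α1 α2 α3 :=
  RingQuot.mkAlgHom K (KRel3 K α1 α2 α3) (ι K (1 : Fin 4))

/-- The generator `c` of `𝒦(α₁, α₂, α₃)`. -/
def K3c (K : Type) [Field K] (α1 α2 α3 : K) : KAlg3 K α1 α2 α3 :=
  RingQuot.mkAlgHom K (KRel3 K α1 α2 α3) (ι K (2 : Fin 4))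

/-- The generator `y` of `𝒦(α₁, α₂, α₃)`. -/
def K3y (K : Type) [Field K] (α1 α2 α3 : K) : KAlg3 K α1 α2 α3 :=
  RingQuot.mkAlgHom K (KRel3 K α1 α2 α3) (ι K (3 : Fin 4))

section TwistedWeyl

variable {K A : Type*} [Field K] [Ring A] [Algebra K A] {ζ β : K} {u w y : A}

/-- If `u * w` and `w * u` are affine in `y` with slopes `ζ` and `ζ ^ 2`, then `u` and `y`
commute up to a primitive cube root of unity. -/
lemma twisted_commute_left (hζ : ζ ^ 2 + ζ + 1 = 0)
    (huw : u * w = β • 1 + ζ • y) (hwu : w * u = β • 1 + ζ ^ 2 • y) :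
    u * y = ζ ^ 2 • (y * u) := by
  have hζ3 : ζ ^ 3 = 1 := by linear_combination (ζ - 1) * hζ
  have h : u * (w * u) = (u * w) * u := (mul_assoc _ _ _).symm
  rw [huw, hwu] at h
  simp only [mul_add, add_mul, mul_smul_comm, smul_mul_assoc, mul_one, one_mul,
    add_right_inj] at h
  have h' := congrArg (fun x => ζ • x) h
  simp only [smul_smul, ← pow_succ', ← pow_two, hζ3, one_smul] at h'
  exact h'

lemma twisted_commute_right (hζ : ζ ^ 2 + ζ + 1 = 0)
    (huw : u * w = β • 1 + ζ • y) (hwu : w * u = β • 1 + ζ ^ 2 • y) :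
    w * y = ζ • (y * w) := by
  have hζ3 : ζ ^ 3 = 1 := by linear_combination (ζ - 1) * hζ
  have h : w * (u * w) = (w * u) * w := (mul_assoc _ _ _).symm
  rw [huw, hwu] at h
  simp only [mul_add, add_mul, mul_smul_comm, smul_mul_assoc, mul_one, one_mul,
    add_right_inj] at h
  have h' := congrArg (fun x => ζ ^ 2 • x) h
  simp only [smul_smul, ← pow_succ, ← pow_add, hζ3, one_smul] at h'
  rw [h', show ζ ^ (2 + 2) = ζ by linear_combination ζ * hζ3]

lemma cube_mul_cube (hζ : ζ ^ 2 + ζ + 1 = 0)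
    (huw : u * w = β • 1 + ζ • y) (hwu : w * u = β • 1 + ζ ^ 2 • y) :
    u ^ 3 * w ^ 3 = β ^ 3 • 1 + y ^ 3 := by
  have huy := twisted_commute_left hζ huw hwu
  have huyz (z : A) : u * (y * z) = ζ ^ 2 • (y * (u * z)) := by
    rw [← mul_assoc, huy, smul_mul_assoc, mul_assoc]
  have huwz (z : A) : u * (w * z) = β • z + ζ • (y * z) := by
    rw [← mul_assoc, huw, add_mul, smul_mul_assoc, smul_mul_assoc, one_mul]
  simp only [pow_succ, pow_zero, one_mul, mul_assoc, mul_add, mul_smul_comm, huw, huwz, huyz,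
    smul_add, smul_smul, mul_one]
  match_scalars <;> grind

lemma add_sq_pow_three (hζ : ζ ^ 2 + ζ + 1 = 0)
    (huw : u * w = β • 1 + ζ • y) (hwu : w * u = β • 1 + ζ ^ 2 • y) (h : u ^ 3 = w ^ 3) :
    (u + w ^ 2) ^ 3 = (3 * β ^ 2) • 1 + (1 + 3 * β) • u ^ 3 + (u ^ 3) ^ 2 := by
  have huy := twisted_commute_left hζ huw hwu
  have hwy := twisted_commute_right hζ huw hwu
  have huyz (z : A) : u * (y * z) = ζ ^ 2 • (y * (u * z)) := by
    rw [← mul_assoc, huy, smul_mul_assoc, mul_assoc]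
  have hwyz (z : A) : w * (y * z) = ζ • (y * (w * z)) := by
    rw [← mul_assoc, hwy, smul_mul_assoc, mul_assoc]
  have huwz (z : A) : u * (w * z) = β • z + ζ • (y * z) := by
    rw [← mul_assoc, huw, add_mul, smul_mul_assoc, smul_mul_assoc, one_mul]
  have h6 : (u ^ 3) ^ 2 = w ^ 6 := by rw [h, ← pow_mul]
  have hw : (1 + 3 * β) • u ^ 3 = u ^ 3 + (3 * β) • w ^ 3 := by rw [h]; module
  rw [h6, hw]
  simp only [pow_succ, pow_zero, one_mul, mul_assoc, mul_add, add_mul, mul_smul_comm,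
    smul_mul_assoc, huw, huwz, huyz, hwu, hwy, hwyz, smul_add, smul_smul, mul_one]
  match_scalars <;> grind

lemma cube_eq_cube {s : A} {γ : K} (huw : u * w = β • 1 + ζ • y)
    (hs : s * s = γ • 1 + y) (hsu : s * u = -(u * s) - w ^ 2) (hsw : s * w = -(w * s) - u ^ 2) :
    u ^ 3 = w ^ 3 := by
  have hsy : s * y = y * s := by
    have h : s * (s * s) = (s * s) * s := (mul_assoc _ _ _).symm
    rw [hs] at h
    simpa [mul_add, add_mul] using h
  have h1 : s * (u * w) = (u * w) * s := by
    simp [huw, mul_add, add_mul, hsy]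
  have h2 : s * (u * w) = (u * w) * s + u ^ 3 - w ^ 3 := by
    rw [← mul_assoc, hsu, sub_mul, neg_mul, mul_assoc, hsw]
    noncomm_ring
  rw [h1] at h2
  rw [← sub_eq_zero]
  simpa [add_sub_assoc] using h2.symm

lemma isUnit_of_pow_three_eq {e t : A} {p q κ : K} (he : e ^ 3 = p • 1 + q • t)
    (ht : t ^ 2 = κ • 1) (hne : p ^ 2 - q ^ 2 * κ ≠ 0) : IsUnit e := by
  have h (r : K) : (p • 1 + r • t) * (p • 1 + (-r) • t) = (p ^ 2 - r ^ 2 * κ) • (1 : A) := by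
    have : t * t = κ • 1 := by rw [← pow_two, ht]
    simp only [mul_add, add_mul, smul_mul_assoc, mul_smul_comm, this, one_mul, mul_one]
    module
  have h' := h (-q)
  rw [neg_neg, neg_sq] at h'
  have hu : IsUnit ((p ^ 2 - q ^ 2 * κ) • (1 : A)) := by
    rw [← Algebra.algebraMap_eq_smul_one]
    exact (isUnit_iff_ne_zero.mpr hne).map _
  have hc : Commute (p • 1 + q • t) (p • 1 + (-q) • t) := (h q).trans h'.symm
  rw [← isUnit_pow_iff three_ne_zero, he]
  exact (hc.isUnit_mul_iff.mp (h q ▸ hu)).1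

end TwistedWeyl

section Relations

variable (K : Type) [Field K] (α1 α2 α3 : K)

lemma K3a_mul_self : K3a K α1 α2 α3 * K3a K α1 α2 α3 = α1 • 1 := by
  simpa [K3a, Algebra.algebraMap_eq_smul_one] using
    RingQuot.mkAlgHom_rel K (KRel3.base (α3 := α3) (KRel.ra (α1 := α1) (α2 := α2)))

lemma K3b_mul_self : K3b K α1 α2 α3 * K3b K α1 α2 α3 = α1 • 1 := by
  simpa [K3b, Algebra.algebraMap_eq_smul_one] using
    RingQuot.mkAlgHom_rel K (KRel3.base (α3 := α3) (KRel.rb (α1 := α1) (α2 := α2)))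

lemma K3c_mul_self : K3c K α1 α2 α3 * K3c K α1 α2 α3 = α1 • 1 := by
  simpa [K3c, Algebra.algebraMap_eq_smul_one] using
    RingQuot.mkAlgHom_rel K (KRel3.base (α3 := α3) (KRel.rc (α1 := α1) (α2 := α2)))

lemma K3_cyclic_sum :
    K3a K α1 α2 α3 * K3b K α1 α2 α3 + K3b K α1 α2 α3 * K3c K α1 α2 α3 +
      K3c K α1 α2 α3 * K3a K α1 α2 α3 = α2 • 1 := by
  simpa [K3a, K3b, K3c, Algebra.algebraMap_eq_smul_one] using
    RingQuot.mkAlgHom_rel K (KRel3.base (α3 := α3) (KRel.r1 (α1 := α1) (α2 := α2)))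

lemma K3_anticyclic_sum :
    K3a K α1 α2 α3 * K3c K α1 α2 α3 + K3c K α1 α2 α3 * K3b K α1 α2 α3 +
      K3b K α1 α2 α3 * K3a K α1 α2 α3 = α2 • 1 + K3y K α1 α2 α3 := by
  simpa [K3a, K3b, K3c, K3y, Algebra.algebraMap_eq_smul_one] using
    RingQuot.mkAlgHom_rel K (KRel3.base (α3 := α3) (KRel.r2 (α1 := α1) (α2 := α2)))

lemma K3y_pow_three : K3y K α1 α2 α3 ^ 3 = α3 • 1 := by
  simpa [K3y, Algebra.algebraMap_eq_smul_one] using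
    RingQuot.mkAlgHom_rel K (KRel3.r3 (α1 := α1) (α2 := α2) (α3 := α3))

end Relations

theorem KAlg3_invertible (K : Type) [Field K] [IsAlgClosed K]
    (h2 : ringChar K ≠ 2) (h3 : ringChar K ≠ 3) (α1 α2 α3 : K) (hα3 : α3 ≠ 0)
    (ζ : K) (hζ : ζ ^ 2 + ζ + 1 = 0) :
    let a := K3a K α1 α2 α3
    let b := K3b K α1 α2 α3
    let c := K3c K α1 α2 α3
    let vp := a + ζ • b + ζ ^ 2 • c
    let vm := a + ζ ^ 2 • b + ζ • c
    ∃ lam : K, IsUnit (vp + lam • vm ^ 2) := by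
  intro a b c vp vm
  have ha : a * a = α1 • 1 := K3a_mul_self K α1 α2 α3
  have hb : b * b = α1 • 1 := K3b_mul_self K α1 α2 α3
  have hc : c * c = α1 • 1 := K3c_mul_self K α1 α2 α3
  have hca : c * a = α2 • 1 - a * b - b * c := by
    rw [← K3_cyclic_sum K α1 α2 α3]; abel
  have hy : K3y K α1 α2 α3 = a * c + c * b + b * a - α2 • 1 := by
    rw [K3_anticyclic_sum K α1 α2 α3]; abel
  have huw : vp * vm = (3 * α1 - α2) • 1 + ζ • K3y K α1 α2 α3 := by
    rw [hy]
    simp only [vp, vm, mul_add, add_mul, smul_mul_assoc, mul_smul_comm, ha, hb, hc, hca]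
    match_scalars <;> grind
  have hwu : vm * vp = (3 * α1 - α2) • 1 + ζ ^ 2 • K3y K α1 α2 α3 := by
    rw [hy]
    simp only [vp, vm, mul_add, add_mul, smul_mul_assoc, mul_smul_comm, ha, hb, hc, hca]
    match_scalars <;> grind
  have hs : (a + b + c) * (a + b + c) = (3 * α1 + 2 * α2) • 1 + K3y K α1 α2 α3 := by
    rw [hy]
    simp only [mul_add, add_mul, ha, hb, hc, hca]
    module
  have hsu : (a + b + c) * vp = -(vp * (a + b + c)) - vm ^ 2 := by
    simp only [vp, vm, pow_two vm, mul_add, add_mul,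
      smul_mul_assoc, mul_smul_comm, ha, hb, hc, hca]
    match_scalars <;> grind
  have hsw : (a + b + c) * vm = -(vm * (a + b + c)) - vp ^ 2 := by
    simp only [vp, vm, pow_two vp, mul_add, add_mul,
      smul_mul_assoc, mul_smul_comm, ha, hb, hc, hca]
    match_scalars <;> grind
  have hcube : vp ^ 3 = vm ^ 3 := cube_eq_cube huw hs hsu hsw
  have ht : (vp ^ 3) ^ 2 = ((3 * α1 - α2) ^ 3 + α3) • 1 := by
    have h := cube_mul_cube hζ huw hwu
    rwa [← hcube, ← pow_two, K3y_pow_three, ← add_smul] at h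
  by_cases hκ : (3 * α1 - α2) ^ 3 + α3 = 0
  · have hK3 : (3 : K) ≠ 0 := by
      intro h
      rcases (Nat.dvd_prime Nat.prime_three).mp ((ringChar.spec K 3).mp (by exact_mod_cast h)) with
        h | h
      · exact CharP.ringChar_ne_one h
      · exact h3 h
    have hβ : 3 * α1 - α2 ≠ 0 := by
      intro h
      simp [h, hα3] at hκ
    refine ⟨1, ?_⟩
    rw [hκ] at ht
    have he := add_sq_pow_three hζ huw hwu hcube
    rw [ht, zero_smul, add_zero] at he
    rw [one_smul]
    exact isUnit_of_pow_three_eq he ht (by simp [hK3, hβ])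
  · refine ⟨0, ?_⟩
    rw [zero_smul, add_zero]
    refine isUnit_of_pow_three_eq (p := 0) (q := 1) ?_ ht (by rwa [zero_pow two_ne_zero, one_pow, one_mul, zero_sub, neg_ne_zero])
    rw [zero_smul, zero_add, one_smul]
end
end

section
/- Let α1, α2 ∈ K and set y = a·c + c·b + b·a − α2 in 𝒯(α1,α2). Then y·a = c·y, y·b = a·y, y·c = b·y, and y·d = d·y. -/
noncomputable section

open FreeAlgebra

/-- The defining relations of the algebra `𝒯(α₁, α₂)`: with generators `a = ι K 0`,
`b = ι K 1`, `c = ι K 2`, `d = ι K 3`, the relations are `a² = b² = c² = d² = α₁`,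
`ca + bc + ab = α₂`, `da + cd + ac = α₂`, `db + ba + ad = α₂`, `dc + cb + bd = α₂`. -/
inductive TRel (K : Type) [Field K] (α1 α2 : K) :
    FreeAlgebra K (Fin 4) → FreeAlgebra K (Fin 4) → Prop
  | ra : TRel K α1 α2 (ι K (0 : Fin 4) * ι K (0 : Fin 4))
      (algebraMap K (FreeAlgebra K (Fin 4)) α1)
  | rb : TRel K α1 α2 (ι K (1 : Fin 4) * ι K (1 : Fin 4))
      (algebraMap K (FreeAlgebra K (Fin 4)) α1)
  | rc : TRel K α1 α2 (ι K (2 : Fin 4) * ι K (2 : Fin 4))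
      (algebraMap K (FreeAlgebra K (Fin 4)) α1)
  | rd : TRel K α1 α2 (ι K (3 : Fin 4) * ι K (3 : Fin 4))
      (algebraMap K (FreeAlgebra K (Fin 4)) α1)
  | r1 : TRel K α1 α2
      (ι K (2 : Fin 4) * ι K (0 : Fin 4) + ι K (1 : Fin 4) * ι K (2 : Fin 4) +
        ι K (0 : Fin 4) * ι K (1 : Fin 4))
      (algebraMap K (FreeAlgebra K (Fin 4)) α2)
  | r2 : TRel K α1 α2
      (ι K (3 : Fin 4) * ι K (0 : Fin 4) + ι K (2 : Fin 4) * ι K (3 : Fin 4) +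
        ι K (0 : Fin 4) * ι K (2 : Fin 4))
      (algebraMap K (FreeAlgebra K (Fin 4)) α2)
  | r3 : TRel K α1 α2
      (ι K (3 : Fin 4) * ι K (1 : Fin 4) + ι K (1 : Fin 4) * ι K (0 : Fin 4) +
        ι K (0 : Fin 4) * ι K (3 : Fin 4))
      (algebraMap K (FreeAlgebra K (Fin 4)) α2)
  | r4 : TRel K α1 α2
      (ι K (3 : Fin 4) * ι K (2 : Fin 4) + ι K (2 : Fin 4) * ι K (1 : Fin 4) +
        ι K (1 : Fin 4) * ι K (3 : Fin 4))
      (algebraMap K (FreeAlgebra K (Fin 4)) α2)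

/-- The algebra `𝒯(α₁, α₂)`: the quotient of the free algebra `K⟨a,b,c,d⟩` by the
two-sided ideal generated by the relations above. -/
abbrev TAlg (K : Type) [Field K] (α1 α2 : K) : Type := RingQuot (TRel K α1 α2)

/-- The generator `a` of `𝒯(α₁, α₂)`. -/
def Ta (K : Type) [Field K] (α1 α2 : K) : TAlg K α1 α2 :=
  RingQuot.mkAlgHom K (TRel K α1 α2) (ι K (0 : Fin 4))

/-- The generator `b` of `𝒯(α₁, α₂)`. -/
def Tb (K : Type) [Field K] (α1 α2 : K) : TAlg K α1 α2 :=
  RingQuot.mkAlgHom K (TRel K α1 α2) (ι K (1 : Fin 4))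

/-- The generator `c` of `𝒯(α₁, α₂)`. -/
def Tc (K : Type) [Field K] (α1 α2 : K) : TAlg K α1 α2 :=
  RingQuot.mkAlgHom K (TRel K α1 α2) (ι K (2 : Fin 4))

/-- The generator `d` of `𝒯(α₁, α₂)`. -/
def Td (K : Type) [Field K] (α1 α2 : K) : TAlg K α1 α2 :=
  RingQuot.mkAlgHom K (TRel K α1 α2) (ι K (3 : Fin 4))

/-- The defining relations of the algebra `𝒯(α₁, α₂, α₃)`: those of `𝒯(α₁, α₂)`
together with `(cb + ba + ac - α₂)³ = α₃`. -/
inductive TRel3 (K : Type) [Field K] (α1 α2 α3 : K) :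
    FreeAlgebra K (Fin 4) → FreeAlgebra K (Fin 4) → Prop
  | base {x y : FreeAlgebra K (Fin 4)} : TRel K α1 α2 x y → TRel3 K α1 α2 α3 x y
  | r5 : TRel3 K α1 α2 α3
      ((ι K (2 : Fin 4) * ι K (1 : Fin 4) + ι K (1 : Fin 4) * ι K (0 : Fin 4) +
        ι K (0 : Fin 4) * ι K (2 : Fin 4) -
        algebraMap K (FreeAlgebra K (Fin 4)) α2) ^ 3)
      (algebraMap K (FreeAlgebra K (Fin 4)) α3)

/-- The algebra `𝒯(α₁, α₂, α₃)`. -/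
abbrev TAlg3 (K : Type) [Field K] (α1 α2 α3 : K) : Type := RingQuot (TRel3 K α1 α2 α3)

/-- The generator `a` of `𝒯(α₁, α₂, α₃)`. -/
def T3a (K : Type) [Field K] (α1 α2 α3 : K) : TAlg3 K α1 α2 α3 :=
  RingQuot.mkAlgHom K (TRel3 K α1 α2 α3) (ι K (0 : Fin 4))

/-- The generator `b` of `𝒯(α₁, α₂, α₃)`. -/
def T3b (K : Type) [Field K] (α1 α2 α3 : K) : TAlg3 K α1 α2 α3 :=
  RingQuot.mkAlgHom K (TRel3 K α1 α2 α3) (ι K (1 : Fin 4))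

/-- The generator `c` of `𝒯(α₁, α₂, α₃)`. -/
def T3c (K : Type) [Field K] (α1 α2 α3 : K) : TAlg3 K α1 α2 α3 :=
  RingQuot.mkAlgHom K (TRel3 K α1 α2 α3) (ι K (2 : Fin 4))

/-- The generator `d` of `𝒯(α₁, α₂, α₃)`. -/
def T3d (K : Type) [Field K] (α1 α2 α3 : K) : TAlg3 K α1 α2 α3 :=
  RingQuot.mkAlgHom K (TRel3 K α1 α2 α3) (ι K (3 : Fin 4))

/-- The element `y = ac + cb + ba - α₂` of `𝒯(α₁, α₂, α₃)`. -/
def T3y (K : Type) [Field K] (α1 α2 α3 : K) : TAlg3 K α1 α2 α3 :=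
  T3a K α1 α2 α3 * T3c K α1 α2 α3 + T3c K α1 α2 α3 * T3b K α1 α2 α3 +
    T3b K α1 α2 α3 * T3a K α1 α2 α3 - algebraMap K (TAlg3 K α1 α2 α3) α2

/-- In any ring, if `a² = b² = c²` is central and `ca + bc + ab = q` is central, then
`y = ac + cb + ba - q` satisfies `ya = cy`. -/
theorem cyclic_sub_mul_eq {R : Type*} [Ring R] {a b c p q : R}
    (ha : a * a = p) (hc : c * c = p) (hpb : p * b = b * p)
    (hqa : q * a = a * q) (hqc : q * c = c * q)
    (h : c * a + b * c + a * b = q) :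
    (a * c + c * b + b * a - q) * a = c * (a * c + c * b + b * a - q) := by
  linear_combination (norm := noncomm_ring)
    a * h - h * c + b * ha - hc * b - ha * b + b * hc - 2 * hpb - hqa - hqc

/-- In any ring, the central-square and central-triangle relations of `𝒯(α₁, α₂)` involving `d`
force `ac + cb + ba` to commute with `d`. -/
theorem cyclic_mul_comm {R : Type*} [Ring R] {a b c d p q : R}
    (ha : a * a = p) (hb : b * b = p) (hc : c * c = p)
    (hpa : p * a = a * p) (hpb : p * b = b * p) (hpc : p * c = c * p)
    (hqa : q * a = a * q) (hqb : q * b = b * q) (hqc : q * c = c * q)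
    (h2 : d * a + c * d + a * c = q) (h3 : d * b + b * a + a * d = q)
    (h4 : d * c + c * b + b * d = q) :
    (a * c + c * b + b * a) * d = d * (a * c + c * b + b * a) := by
  linear_combination (norm := noncomm_ring)
    a * h2 + c * h4 + b * h3 - h2 * c - h4 * b - h3 * a - ha * c - hc * b - hb * a
      + a * hc + c * hb + b * ha - hpa - hpb - hpc - hqa - hqb - hqc

theorem TAlg_yrels (K : Type) [Field K] [IsAlgClosed K]
    (h2 : ringChar K ≠ 2) (h3 : ringChar K ≠ 3) (α1 α2 : K) :
    let a := Ta K α1 α2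
    let b := Tb K α1 α2
    let c := Tc K α1 α2
    let d := Td K α1 α2
    let y := a * c + c * b + b * a - algebraMap K (TAlg K α1 α2) α2
    y * a = c * y ∧ y * b = a * y ∧ y * c = b * y ∧ y * d = d * y := by
  intro a b c d y
  have rel {u v : FreeAlgebra K (Fin 4)} (h : TRel K α1 α2 u v) :
      RingQuot.mkAlgHom K (TRel K α1 α2) u = RingQuot.mkAlgHom K (TRel K α1 α2) v :=
    RingQuot.mkAlgHom_rel K h
  have ha : a * a = algebraMap K (TAlg K α1 α2) α1 := by
    have h := rel .ra
    simp only [map_mul, AlgHom.commutes] at h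
    exact h
  have hb : b * b = algebraMap K (TAlg K α1 α2) α1 := by
    have h := rel .rb
    simp only [map_mul, AlgHom.commutes] at h
    exact h
  have hc : c * c = algebraMap K (TAlg K α1 α2) α1 := by
    have h := rel .rc
    simp only [map_mul, AlgHom.commutes] at h
    exact h
  have h1 : c * a + b * c + a * b = algebraMap K (TAlg K α1 α2) α2 := by
    have h := rel .r1
    simp only [map_add, map_mul, AlgHom.commutes] at h
    exact h
  have h2 : d * a + c * d + a * c = algebraMap K (TAlg K α1 α2) α2 := by
    have h := rel .r2
    simp only [map_add, map_mul, AlgHom.commutes] at h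
    exact h
  have h3 : d * b + b * a + a * d = algebraMap K (TAlg K α1 α2) α2 := by
    have h := rel .r3
    simp only [map_add, map_mul, AlgHom.commutes] at h
    exact h
  have h4 : d * c + c * b + b * d = algebraMap K (TAlg K α1 α2) α2 := by
    have h := rel .r4
    simp only [map_add, map_mul, AlgHom.commutes] at h
    exact h
  have comm (r : K) (x : TAlg K α1 α2) :
      algebraMap K (TAlg K α1 α2) r * x = x * algebraMap K (TAlg K α1 α2) r :=
    Algebra.commutes r x
  have hyb : y = b * a + a * c + c * b - algebraMap K (TAlg K α1 α2) α2 := by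
    simp only [y]; abel
  have hyc : y = c * b + b * a + a * c - algebraMap K (TAlg K α1 α2) α2 := by
    simp only [y]; abel
  refine ⟨cyclic_sub_mul_eq ha hc (comm _ _) (comm _ _) (comm _ _) h1, ?_, ?_, ?_⟩
  · rw [hyb]
    exact cyclic_sub_mul_eq hb ha (comm _ _) (comm _ _) (comm _ _) (by rw [← h1]; abel)
  · rw [hyc]
    exact cyclic_sub_mul_eq hc hb (comm _ _) (comm _ _) (comm _ _) (by rw [← h1]; abel)
  · simp only [y]
    rw [sub_mul, mul_sub, comm α2 d, cyclic_mul_comm ha hb hc (comm _ _) (comm _ _) (comm _ _)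
      (comm _ _) (comm _ _) (comm _ _) h2 h3 h4]
end
end

section
/- For all α1, α2, α3 ∈ K, the algebra 𝒯(α1,α2,α3) is a semisimple ring if and only if α3·(α3 + (α1+α2)·(3α1−α2)²) ≠ 0; and in that case 𝒯(α1,α2,α3) is isomorphic as a K-algebra to the product of two copies of the 6×6 matrix algebra M_6(K). -/
noncomputable section

open FreeAlgebra

namespace TAlg3

/-- Elements `a b c d` of a `K`-algebra satisfying the defining relations of
`𝒯(α₁, α₂, α₃)`. -/
structure Relations {K A : Type} [Field K] [Ring A] [Algebra K A] (α1 α2 α3 : K)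
    (a b c d : A) : Prop where
  aa : a * a = algebraMap K A α1
  bb : b * b = algebraMap K A α1
  cc : c * c = algebraMap K A α1
  dd : d * d = algebraMap K A α1
  abc : c * a + b * c + a * b = algebraMap K A α2
  acd : d * a + c * d + a * c = algebraMap K A α2
  abd : d * b + b * a + a * d = algebraMap K A α2
  bcd : d * c + c * b + b * d = algebraMap K A α2
  cube : (c * b + b * a + a * c - algebraMap K A α2) ^ 3 = algebraMap K A α3

section Lift

variable {K A : Type} [Field K] [Ring A] [Algebra K A] {α1 α2 α3 : K} {a b c d : A}

/-- The universal property of `𝒯(α₁, α₂, α₃)`. -/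
def lift (h : Relations α1 α2 α3 a b c d) : TAlg3 K α1 α2 α3 →ₐ[K] A :=
  RingQuot.liftAlgHom K ⟨FreeAlgebra.lift K ![a, b, c, d], by
    intro x y hxy
    cases hxy with
    | base hxy =>
      cases hxy with
      | ra => simpa using h.aa
      | rb => simpa using h.bb
      | rc => simpa using h.cc
      | rd => simpa using h.dd
      | r1 => simpa using h.abc
      | r2 => simpa using h.acd
      | r3 => simpa using h.abd
      | r4 => simpa using h.bcd
    | r5 => simpa using h.cube⟩

@[simp] lemma lift_a (h : Relations α1 α2 α3 a b c d) : lift h (T3a K α1 α2 α3) = a := by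
  simp [lift, T3a]

@[simp] lemma lift_b (h : Relations α1 α2 α3 a b c d) : lift h (T3b K α1 α2 α3) = b := by
  simp [lift, T3b]

@[simp] lemma lift_c (h : Relations α1 α2 α3 a b c d) : lift h (T3c K α1 α2 α3) = c := by
  simp [lift, T3c]

@[simp] lemma lift_d (h : Relations α1 α2 α3 a b c d) : lift h (T3d K α1 α2 α3) = d := by
  simp [lift, T3d]

variable (K α1 α2 α3) in
lemma relations : Relations α1 α2 α3 (T3a K α1 α2 α3) (T3b K α1 α2 α3) (T3c K α1 α2 α3)
    (T3d K α1 α2 α3) := by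
  have h {x y} (r : TRel K α1 α2 x y) := RingQuot.mkAlgHom_rel K (TRel3.base (α3 := α3) r)
  constructor
  · simpa [T3a] using h .ra
  · simpa [T3b] using h .rb
  · simpa [T3c] using h .rc
  · simpa [T3d] using h .rd
  · simpa [T3a, T3b, T3c] using h .r1
  · simpa [T3a, T3c, T3d] using h .r2
  · simpa [T3a, T3b, T3d] using h .r3
  · simpa [T3b, T3c, T3d] using h .r4
  · simpa [T3a, T3b, T3c] using RingQuot.mkAlgHom_rel K (TRel3.r5 (α1 := α1) (α2 := α2) (α3 := α3))

variable (K α1 α2 α3) in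
lemma adjoin_generators : Algebra.adjoin K {T3a K α1 α2 α3, T3b K α1 α2 α3, T3c K α1 α2 α3,
    T3d K α1 α2 α3} = ⊤ := by
  have h := congrArg (Subalgebra.map (RingQuot.mkAlgHom K (TRel3 K α1 α2 α3)))
    (FreeAlgebra.adjoin_range_ι K (Fin 4))
  rw [AlgHom.map_adjoin, Algebra.map_top,
    AlgHom.range_eq_top _ |>.2 (RingQuot.mkAlgHom_surjective K _)] at h
  rw [← h]
  congr 1
  ext x
  simp [Fin.exists_fin_succ, T3a, T3b, T3c, T3d, eq_comm]

end Lift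

section NormalElement

variable {K A : Type} [Field K] [Ring A] [Algebra K A] {α1 α2 α3 : K} {a b c d : A}

/-- The normal element `y = ac + cb + ba - α₂`. -/
def yElt (α2 : K) (a b c : A) : A := a * c + c * b + b * a - algebraMap K A α2

/-- The deformed braid relation between `a` and `b`. -/
lemma braid (haa : a * a = algebraMap K A α1) (hbb : b * b = algebraMap K A α1)
    (habc : c * a + b * c + a * b = algebraMap K A α2) :
    b * a * b = a * b * a + algebraMap K A α2 * (b - a) := by
  have h1 := Algebra.commutes α1 c
  have h2 := Algebra.commutes α2 b
  linear_combination (norm := noncomm_ring) b * habc - habc * a - hbb * c + c * haa - h1 - h2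

lemma Relations.yElt_pow (h : Relations α1 α2 α3 a b c d) :
    yElt α2 a b c ^ 3 = algebraMap K A α3 := by
  rw [← h.cube, yElt]; congr 1; abel

lemma Relations.a_mul_yElt (h : Relations α1 α2 α3 a b c d) :
    a * yElt α2 a b c = yElt α2 a b c * b := by
  have h1 := Algebra.commutes α1 c
  have h2 := Algebra.commutes α2 a
  rw [yElt]
  linear_combination (norm := noncomm_ring)
    h.aa * c - c * h.bb - braid h.aa h.bb h.abc + h1 + h2

lemma Relations.b_mul_yElt (h : Relations α1 α2 α3 a b c d) :
    b * yElt α2 a b c = yElt α2 a b c * c := by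
  have h1 := Algebra.commutes α1 a
  have h2 := Algebra.commutes α2 b
  have h3 : a * b + c * a + b * c = algebraMap K A α2 := by rw [← h.abc]; abel
  rw [yElt]
  linear_combination (norm := noncomm_ring)
    h.bb * a - a * h.cc - braid h.bb h.cc h3 + h1 + h2

lemma Relations.c_mul_yElt (h : Relations α1 α2 α3 a b c d) :
    c * yElt α2 a b c = yElt α2 a b c * a := by
  have h1 := Algebra.commutes α1 b
  have h2 := Algebra.commutes α2 c
  have h3 : b * c + a * b + c * a = algebraMap K A α2 := by rw [← h.abc]; abel
  rw [yElt]
  linear_combination (norm := noncomm_ring)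
    h.cc * b - b * h.aa - braid h.cc h.aa h3 + h1 + h2

lemma Relations.d_mul_yElt (h : Relations α1 α2 α3 a b c d) :
    d * yElt α2 a b c = yElt α2 a b c * d := by
  have h1 := Algebra.commutes α1 a
  have h2 := Algebra.commutes α1 b
  have h3 := Algebra.commutes α1 c
  have h4 := Algebra.commutes α2 a
  have h5 := Algebra.commutes α2 b
  have h6 := Algebra.commutes α2 c
  have h7 := Algebra.commutes α2 d
  rw [yElt]
  linear_combination (norm := noncomm_ring)
    h.acd * c - c * h.bcd + h.bcd * b - b * h.abd + h.abd * a - a * h.acd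
      + h.aa * c - a * h.cc + h.cc * b - c * h.bb + h.bb * a - b * h.aa
      + h1 + h2 + h3 + h4 + h5 + h6 + h7

end NormalElement

section Spanning

variable {K A : Type} [Field K] [Ring A] [Algebra K A] {α1 α2 α3 : K} {a b c d : A}

/-- The span of the words in `a, b` that are reduced with respect to the braid relation. -/
def wordsAB (K : Type) [Field K] {A : Type} [Ring A] [Algebra K A] (a b : A) : Submodule K A :=
  Submodule.span K (Set.range ![1, a, b, a * b, b * a, a * b * a])

/-- The span of the twelve words `w`, `w * c`, with `w` a reduced word in `a, b`. -/
def wordsABC (K : Type) [Field K] {A : Type} [Ring A] [Algebra K A] (a b c : A) :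
    Submodule K A :=
  wordsAB K a b ⊔ (wordsAB K a b).map (LinearMap.mulRight K c)

lemma wordsAB_induction {P : Submodule K A} {φ : A →ₗ[K] A} (h0 : φ 1 ∈ P) (h1 : φ a ∈ P)
    (h2 : φ b ∈ P) (h3 : φ (a * b) ∈ P) (h4 : φ (b * a) ∈ P) (h5 : φ (a * b * a) ∈ P) :
    (wordsAB K a b).map φ ≤ P := by
  rw [wordsAB, Submodule.map_span_le]
  rintro _ ⟨i, rfl⟩
  fin_cases i <;> simpa

lemma mem_wordsAB (i : Fin 6) :
    (![1, a, b, a * b, b * a, a * b * a] : Fin 6 → A) i ∈ wordsAB K a b :=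
  Submodule.subset_span ⟨i, rfl⟩

lemma Relations.a_mul_wordsAB (h : Relations α1 α2 α3 a b c d) :
    (wordsAB K a b).map (LinearMap.mulLeft K a) ≤ wordsAB K a b := by
  have e0 := mem_wordsAB (K := K) (a := a) (b := b) 0
  have e1 := mem_wordsAB (K := K) (a := a) (b := b) 1
  have e2 := mem_wordsAB (K := K) (a := a) (b := b) 2
  have e3 := mem_wordsAB (K := K) (a := a) (b := b) 3
  have e4 := mem_wordsAB (K := K) (a := a) (b := b) 4
  have e5 := mem_wordsAB (K := K) (a := a) (b := b) 5
  simp at e0 e1 e2 e3 e4 e5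
  have haa (x : A) : a * (a * x) = α1 • x := by
    rw [← mul_assoc, h.aa, Algebra.smul_def]
  apply wordsAB_induction <;> simp only [LinearMap.mulLeft_apply, mul_one, mul_assoc, haa]
  · exact e1
  · rw [h.aa, Algebra.algebraMap_eq_smul_one]; exact Submodule.smul_mem _ _ e0
  · exact e3
  · exact Submodule.smul_mem _ _ e2
  · rwa [mul_assoc] at e5
  · exact Submodule.smul_mem _ _ e4

lemma Relations.b_mul_wordsAB (h : Relations α1 α2 α3 a b c d) :
    (wordsAB K a b).map (LinearMap.mulLeft K b) ≤ wordsAB K a b := by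
  have e0 := mem_wordsAB (K := K) (a := a) (b := b) 0
  have e1 := mem_wordsAB (K := K) (a := a) (b := b) 1
  have e2 := mem_wordsAB (K := K) (a := a) (b := b) 2
  have e3 := mem_wordsAB (K := K) (a := a) (b := b) 3
  have e4 := mem_wordsAB (K := K) (a := a) (b := b) 4
  have e5 := mem_wordsAB (K := K) (a := a) (b := b) 5
  simp at e0 e1 e2 e3 e4 e5
  have hbb (x : A) : b * (b * x) = α1 • x := by
    rw [← mul_assoc, h.bb, Algebra.smul_def]
  have hbab := braid h.aa h.bb h.abc
  apply wordsAB_induction <;> simp only [LinearMap.mulLeft_apply, mul_one]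
  · exact e2
  · exact e4
  · rw [h.bb, Algebra.algebraMap_eq_smul_one]; exact Submodule.smul_mem _ _ e0
  · rw [← mul_assoc, hbab, ← Algebra.smul_def]
    exact add_mem e5 (Submodule.smul_mem _ _ (sub_mem e2 e1))
  · rw [hbb]; exact Submodule.smul_mem _ _ e1
  · have : b * (a * b * a) = α1 • (a * b) + α2 • (b * a - α1 • 1) := by
      rw [← mul_assoc, ← mul_assoc, hbab, add_mul, mul_assoc (a * b), h.aa, ← Algebra.smul_def,
        smul_mul_assoc, sub_mul, h.aa, ← Algebra.commutes, ← Algebra.smul_def,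
        Algebra.algebraMap_eq_smul_one]
    rw [this]
    exact add_mem (Submodule.smul_mem _ _ e3)
      (Submodule.smul_mem _ _ (sub_mem e4 (Submodule.smul_mem _ _ e0)))

lemma Relations.c_mul_wordsAB (h : Relations α1 α2 α3 a b c d) :
    (wordsAB K a b).map (LinearMap.mulLeft K c) ≤
    wordsABC K a b c ⊔ (wordsABC K a b c).map (LinearMap.mulLeft K (yElt α2 a b c)) := by
  have e0 := mem_wordsAB (K := K) (a := a) (b := b) 0
  have e1 := mem_wordsAB (K := K) (a := a) (b := b) 1
  have e2 := mem_wordsAB (K := K) (a := a) (b := b) 2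
  have e3 := mem_wordsAB (K := K) (a := a) (b := b) 3
  have e4 := mem_wordsAB (K := K) (a := a) (b := b) 4
  have e5 := mem_wordsAB (K := K) (a := a) (b := b) 5
  simp at e0 e1 e2 e3 e4 e5
  set y := yElt α2 a b c with hy
  set Z := wordsABC K a b c ⊔ (wordsABC K a b c).map (LinearMap.mulLeft K y)
  have z1 {x : A} (hx : x ∈ wordsAB K a b) : x ∈ Z :=
    Submodule.mem_sup_left (Submodule.mem_sup_left hx)
  have z2 {x : A} (hx : x ∈ wordsAB K a b) : x * c ∈ Z :=
    Submodule.mem_sup_left (Submodule.mem_sup_right ⟨x, hx, rfl⟩)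
  have z3 {x : A} (hx : x ∈ wordsAB K a b) : y * x ∈ Z :=
    Submodule.mem_sup_right ⟨x, Submodule.mem_sup_left hx, rfl⟩
  have z4 {x : A} (hx : x ∈ wordsAB K a b) : y * (x * c) ∈ Z :=
    Submodule.mem_sup_right ⟨_, Submodule.mem_sup_right ⟨x, hx, rfl⟩, rfl⟩
  have hca : c * a = α2 • 1 - b * c - a * b := by
    rw [← Algebra.algebraMap_eq_smul_one, ← h.abc]; abel
  have hcb : c * b = y - b * a - a * c + α2 • 1 := by
    rw [← Algebra.algebraMap_eq_smul_one, hy, yElt]; abel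
  have haa : a * a = α1 • 1 := by rw [← Algebra.algebraMap_eq_smul_one, h.aa]
  have hbb : b * b = α1 • 1 := by rw [← Algebra.algebraMap_eq_smul_one, h.bb]
  have hbab : b * a * b = a * b * a + α2 • (b - a) := by
    rw [braid h.aa h.bb h.abc, Algebra.smul_def]
  have hyc := h.b_mul_yElt
  rw [← hy] at hyc
  have hcab : c * (a * b) = b * a * c - y * c := by
    rw [← mul_assoc, hca, sub_mul, sub_mul, mul_assoc b, hcb, mul_assoc a, hbb]
    simp only [mul_add, mul_sub, hyc, ← mul_assoc, hbb]
    simp only [mul_smul_comm, smul_mul_assoc, one_mul, mul_one]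
    abel
  have hcba : c * (b * a) = y * a + a * b * c := by
    rw [← mul_assoc, hcb, add_mul, sub_mul, sub_mul, mul_assoc b, haa, mul_assoc a c, hca]
    simp only [mul_sub, mul_smul_comm, smul_mul_assoc, one_mul, mul_one, ← mul_assoc, haa]
    abel
  have hcaba : c * (a * b * a) = y * (b * c) + y * (a * b) - α2 • (y * 1) + α2 • (b * a)
      - (a * b * a) * c - α2 • (b * c) + α2 • (a * c) - (α1 * α1) • (1 : A) := by
    rw [← mul_assoc, hcab, sub_mul, mul_assoc y, mul_assoc (b * a), hca]
    simp only [mul_sub, mul_smul_comm, mul_one, ← mul_assoc, hbab, add_mul, sub_mul,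
      smul_mul_assoc, smul_sub]
    rw [mul_assoc b a a, haa]
    simp only [mul_smul_comm, mul_one, smul_mul_assoc, hbb, smul_smul]
    abel
  apply wordsAB_induction <;> simp only [LinearMap.mulLeft_apply]
  · simpa using z2 e0
  · rw [hca]
    exact sub_mem (sub_mem (Submodule.smul_mem _ _ (z1 e0)) (z2 e2)) (z1 e3)
  · rw [hcb]
    simpa using add_mem (sub_mem (sub_mem (z3 e0) (z1 e4)) (z2 e1))
      (Submodule.smul_mem _ α2 (z1 e0))
  · rw [hcab]
    simpa using sub_mem (z2 e4) (z4 e0)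
  · rw [hcba]
    exact add_mem (z3 e1) (z2 e3)
  · rw [hcaba]
    exact sub_mem (add_mem (sub_mem (sub_mem (add_mem (sub_mem (add_mem (z4 e2) (z3 e3))
      (Submodule.smul_mem _ _ (z3 e0))) (Submodule.smul_mem _ _ (z1 e4))) (z2 e5))
      (Submodule.smul_mem _ _ (z2 e2))) (Submodule.smul_mem _ _ (z2 e1)))
      (Submodule.smul_mem _ _ (z1 e0))

lemma Relations.wordsABC_mul_c (h : Relations α1 α2 α3 a b c d) :
    (wordsABC K a b c).map (LinearMap.mulRight K c) ≤ wordsABC K a b c := by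
  rintro _ ⟨x, hx, rfl⟩
  obtain ⟨u, hu, _, ⟨v, hv, rfl⟩, rfl⟩ := Submodule.mem_sup.1 hx
  have : (u + v * c) * c = α1 • v + u * c := by
    rw [add_mul, mul_assoc, h.cc, ← Algebra.commutes, ← Algebra.smul_def, add_comm]
  simp only [LinearMap.mulRight_apply, this]
  exact add_mem (Submodule.smul_mem _ _ (Submodule.mem_sup_left hv))
    (Submodule.mem_sup_right ⟨u, hu, rfl⟩)

lemma Relations.mul_wordsABC (h : Relations α1 α2 α3 a b c d)
    {x : A} (hx : x = a ∨ x = b ∨ x = c) {w : A}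
    (hw : w ∈ wordsABC K a b c) : x * w ∈
      wordsABC K a b c ⊔ (wordsABC K a b c).map (LinearMap.mulLeft K (yElt α2 a b c)) := by
  have key {t : A} (ht : t ∈ wordsAB K a b) : x * t ∈
      wordsABC K a b c ⊔ (wordsABC K a b c).map (LinearMap.mulLeft K (yElt α2 a b c)) := by
    rcases hx with rfl | rfl | rfl
    · exact Submodule.mem_sup_left (Submodule.mem_sup_left (h.a_mul_wordsAB ⟨t, ht, rfl⟩))
    · exact Submodule.mem_sup_left (Submodule.mem_sup_left (h.b_mul_wordsAB ⟨t, ht, rfl⟩))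
    · exact h.c_mul_wordsAB ⟨t, ht, rfl⟩
  obtain ⟨u, hu, _, ⟨v, hv, rfl⟩, rfl⟩ := Submodule.mem_sup.1 hw
  obtain ⟨p, hp, _, ⟨q, hq, rfl⟩, hpq⟩ := Submodule.mem_sup.1 (key hv)
  rw [mul_add]
  refine add_mem (key hu) (Submodule.mem_sup.2 ⟨p * c, h.wordsABC_mul_c ⟨p, hp, rfl⟩, _,
    ⟨q * c, h.wordsABC_mul_c ⟨q, hq, rfl⟩, rfl⟩, ?_⟩)
  simp only [LinearMap.mulLeft_apply, LinearMap.mulRight_apply] at hpq ⊢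
  rw [← mul_assoc, ← mul_assoc, ← add_mul, hpq]

lemma adjoin_mul_mem {s : Set A} {V : Submodule K A} (hs : ∀ x ∈ s, ∀ v ∈ V, x * v ∈ V)
    {x : A} (hx : x ∈ Algebra.adjoin K s) {v : A} (hv : v ∈ V) : x * v ∈ V := by
  induction hx using Algebra.adjoin_induction generalizing v with
  | mem x hx => exact hs x hx v hv
  | algebraMap r => rw [← Algebra.smul_def]; exact V.smul_mem r hv
  | add x y _ _ hx hy => rw [add_mul]; exact add_mem (hx hv) (hy hv)
  | mul x y _ _ hx hy => rw [mul_assoc]; exact hx (hy hv)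

lemma Relations.adjoin_abc_le (h : Relations α1 α2 α3 a b c d) :
    (Algebra.adjoin K {a, b, c}).toSubmodule ≤
    ⨆ i : Fin 3, (wordsABC K a b c).map (LinearMap.mulLeft K (yElt α2 a b c ^ (i : ℕ))) := by
  set y := yElt α2 a b c with hy
  set V := ⨆ i : Fin 3, (wordsABC K a b c).map (LinearMap.mulLeft K (y ^ (i : ℕ)))
  have hV (i : Fin 3) {w : A} (hw : w ∈ wordsABC K a b c) : y ^ (i : ℕ) * w ∈ V :=
    Submodule.mem_iSup_of_mem i ⟨w, hw, rfl⟩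
  have hV' (i : Fin 3) {w : A} (hw : w ∈ wordsABC K a b c) : y ^ (i + 1 : ℕ) * w ∈ V := by
    fin_cases i
    · exact hV 1 hw
    · exact hV 2 hw
    · have := V.smul_mem α3 (hV 0 hw)
      simpa [hy, h.yElt_pow, Algebra.smul_def] using this
  have hx (x : A) (hx : x = a ∨ x = b ∨ x = c) (i : ℕ) :
      ∃ x', (x' = a ∨ x' = b ∨ x' = c) ∧ x * y ^ i = y ^ i * x' := by
    induction i generalizing x with
    | zero => exact ⟨x, hx, by simp⟩
    | succ i ih =>
      obtain ⟨x', hx', e⟩ : ∃ x', (x' = a ∨ x' = b ∨ x' = c) ∧ x * y = y * x' := by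
        rcases hx with rfl | rfl | rfl
        · exact ⟨b, by simp, h.a_mul_yElt⟩
        · exact ⟨c, by simp, h.b_mul_yElt⟩
        · exact ⟨a, by simp, h.c_mul_yElt⟩
      obtain ⟨x'', hx'', e'⟩ := ih x' hx'
      exact ⟨x'', hx'', by rw [pow_succ', ← mul_assoc, e, mul_assoc, e', mul_assoc]⟩
  intro x hxS
  have h1 : (1 : A) ∈ V := by
    simpa using hV 0 (w := 1) (Submodule.mem_sup_left (mem_wordsAB 0))
  rw [← mul_one x]
  refine adjoin_mul_mem (fun z hz v hv ↦ ?_) hxS h1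
  have : V.map (LinearMap.mulLeft K z) ≤ V := by
    rw [Submodule.map_iSup]
    refine iSup_le fun i ↦ ?_
    rintro _ ⟨_, ⟨w, hw, rfl⟩, rfl⟩
    obtain ⟨z', hz', e⟩ := hx z (by simpa using hz) i
    obtain ⟨p, hp, _, ⟨q, hq, rfl⟩, hpq⟩ := Submodule.mem_sup.1 (h.mul_wordsABC hz' hw)
    simp only [LinearMap.mulLeft_apply]
    rw [← mul_assoc, e, mul_assoc, ← hpq, mul_add, LinearMap.mulLeft_apply, ← mul_assoc,
      ← pow_succ]
    exact add_mem (hV i hp) (hV' i hq)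
  exact this ⟨v, hv, rfl⟩

lemma Relations.adjoin_abc_sup (h : Relations α1 α2 α3 a b c d)
    (hgen : Algebra.adjoin K {a, b, c, d} = ⊤) :
    (Algebra.adjoin K {a, b, c}).toSubmodule ⊔
      (Algebra.adjoin K {a, b, c}).toSubmodule.map (LinearMap.mulRight K d) = ⊤ := by
  set S := Algebra.adjoin K {a, b, c}
  set N := S.toSubmodule ⊔ S.toSubmodule.map (LinearMap.mulRight K d)
  have ha : a ∈ S := Algebra.subset_adjoin (by simp)
  have hb : b ∈ S := Algebra.subset_adjoin (by simp)
  have hc : c ∈ S := Algebra.subset_adjoin (by simp)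
  have hN1 {x : A} (hx : x ∈ S) : x ∈ N := Submodule.mem_sup_left hx
  have hN2 {x : A} (hx : x ∈ S) : x * d ∈ N := Submodule.mem_sup_right ⟨x, hx, rfl⟩
  have hSN {x n : A} (hx : x ∈ S) (hn : n ∈ N) : x * n ∈ N := by
    obtain ⟨p, hp, _, ⟨q, hq, rfl⟩, rfl⟩ := Submodule.mem_sup.1 hn
    rw [mul_add, LinearMap.mulRight_apply, ← mul_assoc]
    exact add_mem (hN1 (mul_mem hx hp)) (hN2 (mul_mem hx hq))
  have hNd {n : A} (hn : n ∈ N) : n * d ∈ N := by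
    obtain ⟨p, hp, _, ⟨q, hq, rfl⟩, rfl⟩ := Submodule.mem_sup.1 hn
    rw [add_mul, LinearMap.mulRight_apply, mul_assoc, h.dd]
    exact add_mem (hN2 hp) (hN1 (mul_mem hq (algebraMap_mem S α1)))
  have hdS {x : A} (hx : x ∈ S) : d * x ∈ N := by
    have step {p q r v : A} (e : d * p + q * d + r = algebraMap K A α2) (hq : q ∈ S) (hr : r ∈ S)
        (hvS : v ∈ S) (hv : d * v ∈ N) : d * (p * v) ∈ N := by
      have : d * (p * v) = algebraMap K A α2 * v - q * (d * v) - r * v := by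
        rw [← e]; noncomm_ring
      rw [this]
      exact sub_mem (sub_mem (hN1 (mul_mem (algebraMap_mem S α2) hvS)) (hSN hq hv))
        (hN1 (mul_mem hr hvS))
    have h1 : (1 : A) ∈ S.toSubmodule ⊓ N.comap (LinearMap.mulLeft K d) :=
      ⟨one_mem S, by simpa using hN2 (one_mem S)⟩
    have := adjoin_mul_mem (s := {a, b, c}) ?_ hx h1
    · simpa using this.2
    rintro z hz v ⟨hv, hv'⟩
    change v ∈ S at hv
    change d * v ∈ N at hv'
    refine ⟨S.mul_mem (Algebra.subset_adjoin hz) hv, ?_⟩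
    change d * (z * v) ∈ N
    obtain rfl | hz | rfl := hz
    · exact step h.acd hc (mul_mem ha hc) hv hv'
    · subst hz
      exact step (q := a) (r := z * a) (by rw [← h.abd]; abel) ha (mul_mem hb ha) hv hv'
    · exact step (q := b) (r := z * b) (by rw [← h.bcd]; abel) hb (mul_mem hc hb) hv hv'
  have hdN {n : A} (hn : n ∈ N) : d * n ∈ N := by
    obtain ⟨p, hp, _, ⟨q, hq, rfl⟩, rfl⟩ := Submodule.mem_sup.1 hn
    rw [mul_add, LinearMap.mulRight_apply, ← mul_assoc]
    exact add_mem (hdS hp) (hNd (hdS hq))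
  refine eq_top_iff.2 fun x _ ↦ ?_
  have hx : x ∈ Algebra.adjoin K {a, b, c, d} := hgen ▸ Algebra.mem_top
  rw [← mul_one x]
  refine adjoin_mul_mem (fun z hz v hv ↦ ?_) hx (hN1 (one_mem S))
  rcases hz with rfl | rfl | rfl | rfl
  exacts [hSN ha hv, hSN hb hv, hSN hc hv, hdN hv]

end Spanning

lemma finrank_wordsAB_le {K A : Type} [Field K] [Ring A] [Algebra K A] (a b : A) :
    Module.finrank K (wordsAB K a b) ≤ 6 :=
  (finrank_range_le_card (R := K) ![1, a, b, a * b, b * a, a * b * a]).trans (by simp)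

instance {K A : Type} [Field K] [Ring A] [Algebra K A] (a b : A) :
    Module.Finite K (wordsAB K a b) :=
  Module.Finite.span_of_finite K (Set.finite_range _)

instance {K A : Type} [Field K] [Ring A] [Algebra K A] (a b c : A) :
    Module.Finite K (wordsABC K a b c) := by
  unfold wordsABC; infer_instance

lemma finrank_wordsABC_le {K A : Type} [Field K] [Ring A] [Algebra K A] (a b c : A) :
    Module.finrank K (wordsABC K a b c) ≤ 12 := by
  have h := finrank_wordsAB_le (K := K) a b
  have h1 := Submodule.finrank_add_le_finrank_add_finrank (wordsAB K a b)
    ((wordsAB K a b).map (LinearMap.mulRight K c))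
  have h2 := Submodule.finrank_map_le (LinearMap.mulRight K c) (wordsAB K a b)
  rw [wordsABC]
  lia

lemma finite_and_finrank_le (K : Type) [Field K] (α1 α2 α3 : K) :
    Module.Finite K (TAlg3 K α1 α2 α3) ∧ Module.finrank K (TAlg3 K α1 α2 α3) ≤ 72 := by
  have h := relations K α1 α2 α3
  set a := T3a K α1 α2 α3
  set b := T3b K α1 α2 α3
  set c := T3c K α1 α2 α3
  set d := T3d K α1 α2 α3
  set S := (Algebra.adjoin K {a, b, c}).toSubmodule
  let V (i : Fin 3) := (wordsABC K a b c).map (LinearMap.mulLeft K (yElt α2 a b c ^ (i : ℕ)))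
  have hle : S ≤ ⨆ i, V i := h.adjoin_abc_le
  have hS : Module.Finite K S := Submodule.finiteDimensional_of_le hle
  have hV (i : Fin 3) : Module.finrank K (V i) ≤ 12 :=
    (Submodule.finrank_map_le _ _).trans (finrank_wordsABC_le a b c)
  have hS' : Module.finrank K S ≤ 36 := by
    refine (Submodule.finrank_mono hle).trans ?_
    have h1 := Submodule.finrank_add_le_finrank_add_finrank (V 0) (V 1)
    have h2 := Submodule.finrank_add_le_finrank_add_finrank (V 0 ⊔ V 1) (V 2)
    have h3 : ⨆ i, V i = V 0 ⊔ V 1 ⊔ V 2 :=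
      le_antisymm (iSup_le fun i ↦ by
        fin_cases i
        · exact le_sup_left.trans le_sup_left
        · exact le_sup_right.trans le_sup_left
        · exact le_sup_right)
        (sup_le (sup_le (le_iSup _ _) (le_iSup _ _)) (le_iSup _ _))
    rw [h3]
    have := hV 0
    have := hV 1
    have := hV 2
    lia
  have htop := h.adjoin_abc_sup (adjoin_generators K α1 α2 α3)
  have hfin : Module.Finite K (⊤ : Submodule K (TAlg3 K α1 α2 α3)) := by
    rw [← htop]; infer_instance
  refine ⟨Module.Finite.equiv (Submodule.topEquiv (R := K)), ?_⟩
  rw [← finrank_top, ← htop]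
  have h1 := Submodule.finrank_add_le_finrank_add_finrank S (S.map (LinearMap.mulRight K d))
  have h2 := Submodule.finrank_map_le (LinearMap.mulRight K d) S
  exact h1.trans (by lia)

section Fourier

variable {K A : Type} [Field K] [Ring A] [Algebra K A] {α1 α2 α3 ω : K} {s u v d y : A}

/-- The relations of `𝒯(α₁, α₂, α₃)`, in terms of `d`, of the normal element `y` and of the
discrete Fourier transform `s, u, v` of `a, b, c`. -/
structure FourierRelations (α1 α2 α3 ω : K) (s u v d y : A) : Prop where
  ss : s * s = (3 * α1 + 2 * α2) • (1 : A) + y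
  uv : u * v = (3 * α1 - α2) • (1 : A) + ω • y
  vu : v * u = (3 * α1 - α2) • (1 : A) + ω ^ 2 • y
  su : s * u = -(u * s) - v * v
  sv : s * v = -(v * s) - u * u
  dd : d * d = α1 • (1 : A)
  ds : d * s = -(s * d) + (2 * α2) • (1 : A) - y
  du : d * u = -ω • (u * d) - ((1 - ω) * ω / 3) • (s * u - ω • (u * s))
  dv : d * v = -ω ^ 2 • (v * d) - ((1 - ω ^ 2) * ω ^ 2 / 3) • (s * v - ω ^ 2 • (v * s))
  cube : y ^ 3 = α3 • (1 : A)

lemma FourierRelations.relations (hω : ω ^ 2 + ω + 1 = 0) (h3 : (3 : K) ≠ 0)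
    (h : FourierRelations α1 α2 α3 ω s u v d y) :
    Relations α1 α2 α3 ((3 : K)⁻¹ • (s + u + v)) ((3 : K)⁻¹ • (s + ω ^ 2 • u + ω • v))
      ((3 : K)⁻¹ • (s + ω • u + ω ^ 2 • v)) d := by
  obtain ⟨r, hr⟩ : ∃ r : K, r = 3⁻¹ := ⟨_, rfl⟩
  have hr3 : 3 * r = 1 := by rw [hr]; exact mul_inv_cancel₀ h3
  rw [← hr]
  have hdu := h.du
  have hdv := h.dv
  rw [div_eq_mul_inv, ← hr, h.su] at hdu
  rw [div_eq_mul_inv, ← hr, h.sv] at hdv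
  have hy : (r • (s + ω • u + ω ^ 2 • v)) * (r • (s + ω ^ 2 • u + ω • v))
      + (r • (s + ω ^ 2 • u + ω • v)) * (r • (s + u + v))
      + (r • (s + u + v)) * (r • (s + ω • u + ω ^ 2 • v)) - algebraMap K A α2 = y := by
    simp only [Algebra.algebraMap_eq_smul_one, mul_add, add_mul, smul_mul_assoc, mul_smul_comm,
      h.ss, h.uv, h.vu, h.su, h.sv, smul_add, smul_sub, smul_neg, smul_smul]
    match_scalars <;> grind
  constructor
  case cube => rw [hy, h.cube, Algebra.algebraMap_eq_smul_one]
  all_goals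
    simp only [Algebra.algebraMap_eq_smul_one, mul_add, add_mul, smul_mul_assoc, mul_smul_comm,
      h.ss, h.uv, h.vu, h.su, h.sv, h.dd, h.ds, hdu, hdv, smul_add, smul_sub, smul_neg, smul_smul]
    try match_scalars <;> grind

end Fourier

section MatrixModel

open Matrix

variable {K C : Type} [Field K] [Ring C] [Algebra K C] {α1 α2 θ ω κ0 κ1 κ2 : K} {S W D : C}

/-- The Clifford relations satisfied by the entries of the matrix model of `𝒯(α₁, α₂, θ³)`. -/
structure CliffordRelations (α1 α2 θ ω κ0 κ1 κ2 : K) (S W D : C) : Prop where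
  SS : S * S = (3 * α1 + 2 * α2 + θ) • (1 : C)
  WW : W * W = (κ0 * κ1 * κ2) • (1 : C)
  DD : D * D = α1 • (1 : C)
  DS : D * S = -(S * D) + (2 * α2 - θ) • (1 : C)
  WS : W * S = -(S * W) + (κ0 * κ2 - κ1 * κ2 - κ0 * κ1) • (1 : C)
  DW : D * W = -(W * D) + ((1 - ω) / 3 * (-ω * κ1 * κ2 + (-ω - 2 * ω ^ 2) * κ0 * κ2
    + ω * κ0 * κ1)) • (1 : C)

variable (C) in
/-- The image of the normal element `y` in the matrix model. -/
def matY (θ ω : K) : Matrix (Fin 3) (Fin 3) C :=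
  diagonal ![θ • 1, (ω * θ) • 1, (ω ^ 2 * θ) • 1]

/-- The image of `u` in the matrix model. -/
def matU (W : C) : Matrix (Fin 3) (Fin 3) C := !![0, 0, W; 1, 0, 0; 0, 1, 0]

/-- The image of `v` in the matrix model. -/
def matV (κ0 κ1 : K) (W : C) : Matrix (Fin 3) (Fin 3) C :=
  !![0, κ0 • 1, 0; 0, 0, κ1 • 1; (κ0⁻¹ * κ1⁻¹) • W, 0, 0]

/-- The image of `s` in the matrix model. -/
def matS (κ0 κ1 : K) (S W : C) : Matrix (Fin 3) (Fin 3) C :=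
  diagonal ![S, -S - κ0⁻¹ • W, S + (κ0⁻¹ - κ1⁻¹) • W]

/-- The image of `d` in the matrix model. -/
def matD (ω κ0 κ1 : K) (S W D : C) : Matrix (Fin 3) (Fin 3) C :=
  diagonal ![D, -ω • D - ((1 - ω) / 3) • S + ((1 - ω) * ω / 3 * κ0⁻¹) • W,
    ω ^ 2 • D + ((1 - ω) / 3) • (-ω ^ 2 • S + ((1 - ω ^ 2) * κ0⁻¹ + ω * κ1⁻¹) • W)]

set_option maxHeartbeats 4000000 in
lemma CliffordRelations.fourierRelations (hω : ω ^ 2 + ω + 1 = 0) (h3 : (3 : K) ≠ 0)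
    (e0 : κ0 = 3 * α1 - α2 + ω ^ 2 * θ) (e1 : κ1 = 3 * α1 - α2 + θ)
    (e2 : κ2 = 3 * α1 - α2 + ω * θ) (hκ0 : κ0 ≠ 0) (hκ1 : κ1 ≠ 0)
    (h : CliffordRelations α1 α2 θ ω κ0 κ1 κ2 S W D) :
    FourierRelations α1 α2 (θ ^ 3) ω (matS κ0 κ1 S W) (matU W) (matV κ0 κ1 W)
      (matD ω κ0 κ1 S W D) (matY C θ ω) := by
  obtain ⟨r, hr⟩ : ∃ r : K, r = 3⁻¹ := ⟨_, rfl⟩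
  have hr3 : 3 * r = 1 := by rw [hr]; exact mul_inv_cancel₀ h3
  obtain ⟨i0, hi0⟩ : ∃ r : K, r = κ0⁻¹ := ⟨_, rfl⟩
  have hk0 : κ0 * i0 = 1 := by rw [hi0]; exact mul_inv_cancel₀ hκ0
  obtain ⟨i1, hi1⟩ : ∃ r : K, r = κ1⁻¹ := ⟨_, rfl⟩
  have hk1 : κ1 * i1 = 1 := by rw [hi1]; exact mul_inv_cancel₀ hκ1
  have hDW := h.DW
  rw [div_eq_mul_inv, ← hr] at hDW
  constructor
  all_goals
    ext i j
    fin_cases i <;> fin_cases j <;>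
    simp [matS, matU, matV, matD, matY, Matrix.vecMul_diagonal, Matrix.mul_apply,
      Fin.sum_univ_three, div_eq_mul_inv, ← hr, ← hi0, ← hi1, pow_succ]
  all_goals
    try simp only [mul_add, add_mul, mul_sub, sub_mul, smul_mul_assoc, mul_smul_comm, neg_mul,
      mul_neg, one_mul, h.SS, h.WW, h.DD, h.DS, h.WS, hDW, smul_add, smul_sub, smul_neg, smul_smul]
    try match_scalars
  all_goals clear h hDW hr hi0 hi1
  all_goals grind

/-- A subalgebra of `M₃(C)` containing the matrix model is everything. -/
lemma matrixModel_generates (hω : ω ^ 2 + ω + 1 = 0) (h3 : (3 : K) ≠ 0) (hθ : θ ≠ 0)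
    (hκ0 : κ0 ≠ 0) (hκ1 : κ1 ≠ 0) (hC : Algebra.adjoin K {S, W, D} = ⊤)
    {R : Subalgebra K (Matrix (Fin 3) (Fin 3) C)} (hs : matS κ0 κ1 S W ∈ R) (hu : matU W ∈ R)
    (hv : matV κ0 κ1 W ∈ R) (hd : matD ω κ0 κ1 S W D ∈ R) (hy : matY C θ ω ∈ R) : R = ⊤ := by
  obtain ⟨r, hr⟩ : ∃ r : K, 3 * r = 1 := ⟨_, mul_inv_cancel₀ h3⟩
  obtain ⟨i, hi⟩ : ∃ i : K, θ * i = 1 := ⟨_, mul_inv_cancel₀ hθ⟩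
  have idem (ζ : K) : r • (1 + (ζ * i) • matY C θ ω
      + (ζ ^ 2 * i ^ 2) • (matY C θ ω * matY C θ ω)) ∈ R :=
    R.smul_mem (add_mem (add_mem (one_mem R) (R.smul_mem hy _)) (R.smul_mem (mul_mem hy hy) _)) _
  have e00 : single (0 : Fin 3) (0 : Fin 3) (1 : C) ∈ R := by
    convert idem 1
    ext i j
    fin_cases i <;> fin_cases j <;> simp [matY, single, one_apply] <;> match_scalars <;> grind
  have e11 : single (1 : Fin 3) (1 : Fin 3) (1 : C) ∈ R := by
    convert idem (ω ^ 2)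
    ext i j
    fin_cases i <;> fin_cases j <;> simp [matY, single, one_apply] <;> match_scalars <;> grind
  have e22 : single (2 : Fin 3) (2 : Fin 3) (1 : C) ∈ R := by
    convert idem ω
    ext i j
    fin_cases i <;> fin_cases j <;> simp [matY, single, one_apply] <;> match_scalars <;> grind
  have e10 : single (1 : Fin 3) (0 : Fin 3) (1 : C) ∈ R := by
    convert mul_mem e11 hu
    ext i j
    fin_cases i <;> fin_cases j <;> simp [matU, single, mul_apply]
  have e21 : single (2 : Fin 3) (1 : Fin 3) (1 : C) ∈ R := by
    convert mul_mem e22 hu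
    ext i j
    fin_cases i <;> fin_cases j <;> simp [matU, single, mul_apply]
  have e01 : single (0 : Fin 3) (1 : Fin 3) (1 : C) ∈ R := by
    convert R.smul_mem (mul_mem e00 hv) κ0⁻¹
    ext i j
    fin_cases i <;> fin_cases j <;> simp [matV, single, mul_apply, hκ0]
  have e12 : single (1 : Fin 3) (2 : Fin 3) (1 : C) ∈ R := by
    convert R.smul_mem (mul_mem e11 hv) κ1⁻¹
    ext i j
    fin_cases i <;> fin_cases j <;> simp [matV, single, mul_apply, hκ1]
  have e20 : single (2 : Fin 3) (0 : Fin 3) (1 : C) ∈ R := by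
    simpa using mul_mem e21 e10
  have e02 : single (0 : Fin 3) (2 : Fin 3) (1 : C) ∈ R := by
    simpa using mul_mem e01 e12
  have h00 (x : C) : single (0 : Fin 3) (0 : Fin 3) x ∈ R := by
    have hx : x ∈ Algebra.adjoin K {S, W, D} := hC ▸ Algebra.mem_top
    induction hx using Algebra.adjoin_induction with
    | mem x hx =>
      obtain rfl | rfl | rfl := hx
      · convert mul_mem e00 hs
        ext i j
        fin_cases i <;> fin_cases j <;> simp [matS, single]
      · have : single (0 : Fin 3) (2 : Fin 3) x ∈ R := by
          convert mul_mem e00 hu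
          ext i j
          fin_cases i <;> fin_cases j <;> simp [matU, single, mul_apply]
        simpa using mul_mem this e20
      · convert mul_mem e00 hd
        ext i j
        fin_cases i <;> fin_cases j <;> simp [matD, single]
    | algebraMap t =>
      rw [Algebra.algebraMap_eq_smul_one, ← smul_single]
      exact R.smul_mem e00 t
    | add x y _ _ hx hy => rw [single_add]; exact add_mem hx hy
    | mul x y _ _ hx hy => simpa using mul_mem hx hy
  have hcol (i : Fin 3) : single i (0 : Fin 3) (1 : C) ∈ R := by
    fin_cases i <;> assumption
  have hrow (j : Fin 3) : single (0 : Fin 3) j (1 : C) ∈ R := by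
    fin_cases j <;> assumption
  refine eq_top_iff.2 fun M _ ↦ ?_
  rw [matrix_eq_sum_single M]
  refine sum_mem fun i _ ↦ sum_mem fun j _ ↦ ?_
  simpa using mul_mem (mul_mem (hcol i) (h00 (M i j))) (hrow j)

end MatrixModel

section QuadraticForms

open Matrix CliffordAlgebra

variable {K : Type} [Field K] {n : Type} [Fintype n] [DecidableEq n]

lemma toQuadraticForm'_apply (M : Matrix n n K) (x : n → K) :
    M.toQuadraticForm' x = x ⬝ᵥ M *ᵥ x := by
  rw [toQuadraticForm', LinearMap.BilinMap.toQuadraticMap_apply, toLinearMap₂'_apply']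

lemma polar_toQuadraticForm' (M : Matrix n n K) (x y : n → K) :
    QuadraticMap.polar M.toQuadraticForm' x y = x ⬝ᵥ M *ᵥ y + y ⬝ᵥ M *ᵥ x := by
  simp only [QuadraticMap.polar, toQuadraticForm'_apply, mulVec_add, dotProduct_add,
    add_dotProduct]
  ring

lemma toQuadraticForm'_equivalent [IsAlgClosed K] [Invertible (2 : K)] {M N : Matrix n n K}
    (hM : M.IsSymm) (hN : N.IsSymm) (hM' : M.det ≠ 0) (hN' : N.det ≠ 0) :
    M.toQuadraticForm'.Equivalent N.toQuadraticForm' := by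
  have key {P : Matrix n n K} (hP : P.IsSymm) (hP' : P.det ≠ 0) :
      (QuadraticMap.associated (R := K) P.toQuadraticForm').SeparatingLeft := by
    rw [toQuadraticForm', QuadraticMap.associated_left_inverse]
    · exact LinearMap.separatingLeft_toLinearMap₂'_iff_det_ne_zero.2 hP'
    · intro x y
      rw [toLinearMap₂'_apply', toLinearMap₂'_apply', dotProduct_mulVec, ← mulVec_transpose, hP,
        dotProduct_comm]
  exact QuadraticForm.equivalent_of_isAlgClosed _ _ (key hM hM') (key hN hN')

lemma adjoin_range_ι_single (Q : QuadraticForm K (n → K)) :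
    Algebra.adjoin K (Set.range fun i ↦ ι Q (Pi.single i 1)) = ⊤ := by
  rw [eq_top_iff, ← CliffordAlgebra.adjoin_range_ι, Algebra.adjoin_le_iff]
  rintro _ ⟨x, rfl⟩
  have hx : x = ∑ i, x i • Pi.single i 1 := by
    ext j
    simp [Pi.single_apply]
  rw [hx, map_sum]
  refine sum_mem fun i _ ↦ ?_
  rw [map_smul]
  exact Subalgebra.smul_mem _ (Algebra.subset_adjoin (Set.mem_range_self i)) _

lemma ι_mul_mul_ι {M : Matrix n n K} (hM : M.IsSymm) {r : n → K} (hr : M *ᵥ r = 0)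
    (c : CliffordAlgebra M.toQuadraticForm') :
    ι M.toQuadraticForm' r * c * ι M.toQuadraticForm' r = 0 := by
  have h0 : ι M.toQuadraticForm' r * ι M.toQuadraticForm' r = 0 := by
    rw [ι_sq_scalar, toQuadraticForm'_apply, hr, dotProduct_zero, map_zero]
  have h1 (x : n → K) : ι M.toQuadraticForm' r * ι M.toQuadraticForm' x
      = - (ι M.toQuadraticForm' x * ι M.toQuadraticForm' r) := by
    rw [eq_neg_iff_add_eq_zero, ι_mul_ι_add_swap, polar_toQuadraticForm', hr, dotProduct_mulVec,
      ← mulVec_transpose, hM, hr]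
    simp
  induction c using CliffordAlgebra.left_induction with
  | algebraMap t => rw [← Algebra.commutes, mul_assoc, h0, mul_zero]
  | add x y hx hy => rw [mul_add, add_mul, hx, hy, add_zero]
  | ι_mul x v hx => rw [← mul_assoc, h1, neg_mul, neg_mul, mul_assoc, mul_assoc, ← mul_assoc _ x,
      hx, mul_zero, neg_zero]

lemma ι_ne_zero {V : Type} [AddCommGroup V] [Module K V] [Invertible (2 : K)]
    (Q : QuadraticForm K V) {r : V} (hr : r ≠ 0) : ι Q r ≠ 0 := by
  intro h
  have := congrArg (equivExterior Q) h
  rw [map_zero, equivExterior, changeFormEquiv_apply, changeForm_ι] at this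
  exact hr ((ExteriorAlgebra.ι_eq_zero_iff r).1 this)

end QuadraticForms

section Surjections

open Matrix

variable {K : Type} [Field K] {α1 α2 θ ω κ0 κ1 κ2 : K}

/-- The Gram matrix of the quadratic form encoded by `CliffordRelations`. -/
def gram (α1 α2 θ ω κ0 κ1 κ2 : K) : Matrix (Fin 3) (Fin 3) K :=
  let p01 := (κ0 * κ2 - κ1 * κ2 - κ0 * κ1) / 2
  let p02 := (2 * α2 - θ) / 2
  let p12 := (1 - ω) / 3 * (-ω * κ1 * κ2 + (-ω - 2 * ω ^ 2) * κ0 * κ2 + ω * κ0 * κ1) / 2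
  !![3 * α1 + 2 * α2 + θ, p01, p02; p01, κ0 * κ1 * κ2, p12; p02, p12, α1]

lemma isSymm_gram : (gram α1 α2 θ ω κ0 κ1 κ2).IsSymm := by
  ext i j
  fin_cases i <;> fin_cases j <;> rfl

lemma det_gram (h2 : (2 : K) ≠ 0) (h3 : (3 : K) ≠ 0) (hω : ω ^ 2 + ω + 1 = 0)
    (e0 : κ0 = 3 * α1 - α2 + ω ^ 2 * θ) (e1 : κ1 = 3 * α1 - α2 + θ)
    (e2 : κ2 = 3 * α1 - α2 + ω * θ) : (gram α1 α2 θ ω κ0 κ1 κ2).det =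
      -(9 / 4) * θ ^ 2 * (θ ^ 3 + (α1 + α2) * (3 * α1 - α2) ^ 2) := by
  have h4 : (4 : K) = 2 * 2 := by norm_num
  simp only [gram, det_fin_three]
  simp only [Fin.isValue, of_apply, cons_val', cons_val_zero, cons_val_fin_one, cons_val_one,
    cons_val]
  rw [e0, e1, e2, h4]
  field_simp
  grind

lemma cliffordRelations_ι (h2 : (2 : K) ≠ 0) : CliffordRelations α1 α2 θ ω κ0 κ1 κ2
    (CliffordAlgebra.ι (gram α1 α2 θ ω κ0 κ1 κ2).toQuadraticForm' (Pi.single 0 1))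
    (CliffordAlgebra.ι (gram α1 α2 θ ω κ0 κ1 κ2).toQuadraticForm' (Pi.single 1 1))
    (CliffordAlgebra.ι (gram α1 α2 θ ω κ0 κ1 κ2).toQuadraticForm' (Pi.single 2 1)) := by
  constructor
  case SS | WW | DD =>
    rw [CliffordAlgebra.ι_sq_scalar, toQuadraticForm'_apply, Algebra.algebraMap_eq_smul_one]
    simp [gram]
  all_goals
    rw [← sub_eq_iff_eq_add', sub_neg_eq_add, CliffordAlgebra.ι_mul_ι_add_swap,
      polar_toQuadraticForm', Algebra.algebraMap_eq_smul_one]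
    congr 1
    simp [gram]
    field_simp
    ring

lemma lift_surjective {α3 : K} {A : Type} [Ring A] [Algebra K A] {s u v d y : A}
    (hω : ω ^ 2 + ω + 1 = 0) (h3 : (3 : K) ≠ 0) (h : FourierRelations α1 α2 α3 ω s u v d y)
    (hA : ∀ R : Subalgebra K A, s ∈ R → u ∈ R → v ∈ R → d ∈ R → y ∈ R → R = ⊤) :
    Function.Surjective (lift (h.relations hω h3)) := by
  set φ := lift (h.relations hω h3)
  have ha := AlgHom.mem_range_self φ (T3a K α1 α2 α3)
  have hb := AlgHom.mem_range_self φ (T3b K α1 α2 α3)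
  have hc := AlgHom.mem_range_self φ (T3c K α1 α2 α3)
  have hd := AlgHom.mem_range_self φ (T3d K α1 α2 α3)
  rw [lift_a] at ha
  rw [lift_b] at hb
  rw [lift_c] at hc
  rw [lift_d] at hd
  obtain ⟨r, hr⟩ : ∃ r : K, r = 3⁻¹ := ⟨_, rfl⟩
  have hr3 : 3 * r = 1 := by rw [hr]; exact mul_inv_cancel₀ h3
  rw [← hr] at ha hb hc
  have hs : s ∈ φ.range := by
    convert add_mem (add_mem ha hb) hc using 1
    match_scalars <;> grind
  refine AlgHom.range_eq_top _ |>.1 (hA φ.range hs ?_ ?_ hd ?_)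
  · convert add_mem (add_mem ha (φ.range.smul_mem hb ω)) (φ.range.smul_mem hc (ω ^ 2)) using 1
    match_scalars <;> grind
  · convert add_mem (add_mem ha (φ.range.smul_mem hb (ω ^ 2))) (φ.range.smul_mem hc ω) using 1
    match_scalars <;> grind
  · rw [← sub_eq_iff_eq_add'.2 h.ss]
    exact sub_mem (mul_mem hs hs) (φ.range.smul_mem (one_mem _) _)

lemma exists_surjective_matrix_clifford (h2 : (2 : K) ≠ 0) (h3 : (3 : K) ≠ 0)
    (hω : ω ^ 2 + ω + 1 = 0) (hθ : θ ≠ 0) (e0 : κ0 = 3 * α1 - α2 + ω ^ 2 * θ)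
    (e1 : κ1 = 3 * α1 - α2 + θ) (e2 : κ2 = 3 * α1 - α2 + ω * θ) (hκ0 : κ0 ≠ 0) (hκ1 : κ1 ≠ 0) :
    ∃ φ : TAlg3 K α1 α2 (θ ^ 3) →ₐ[K] Matrix (Fin 3) (Fin 3)
      (CliffordAlgebra (gram α1 α2 θ ω κ0 κ1 κ2).toQuadraticForm'), Function.Surjective φ := by
  refine ⟨_, lift_surjective hω h3
    ((cliffordRelations_ι h2).fourierRelations hω h3 e0 e1 e2 hκ0 hκ1) fun R hs hu hv hd hy ↦
      matrixModel_generates hω h3 hθ hκ0 hκ1 ?_ hs hu hv hd hy⟩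
  convert adjoin_range_ι_single (gram α1 α2 θ ω κ0 κ1 κ2).toQuadraticForm'
  ext x
  simp [Fin.exists_fin_succ, eq_comm]

/-- A realisation of the Clifford algebra of the standard quadratic form in three variables by
pairs of Pauli matrices. -/
def pauli (I : K) : (Fin 3 → K) →ₗ[K] Matrix (Fin 2) (Fin 2) K × Matrix (Fin 2) (Fin 2) K where
  toFun x := (!![x 0, x 1 - I * x 2; x 1 + I * x 2, -x 0],
    -!![x 0, x 1 - I * x 2; x 1 + I * x 2, -x 0])
  map_add' x y := by
    ext i j <;> fin_cases i <;> fin_cases j <;> simp <;> ring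
  map_smul' t x := by
    ext i j <;> fin_cases i <;> fin_cases j <;> simp <;> ring

lemma pauli_generates (h2 : (2 : K) ≠ 0) {I : K} (hI : I * I = -1)
    {R : Subalgebra K (Matrix (Fin 2) (Fin 2) K × Matrix (Fin 2) (Fin 2) K)}
    (hR : ∀ x, pauli I x ∈ R) : R = ⊤ := by
  obtain ⟨r, hr⟩ : ∃ r : K, 2 * r = 1 := ⟨_, mul_inv_cancel₀ h2⟩
  have h1 : ((1, 0) : Matrix (Fin 2) (Fin 2) K × Matrix (Fin 2) (Fin 2) K) ∈ R := by
    convert R.smul_mem (sub_mem (one_mem R) (R.smul_mem (mul_mem (mul_mem (hR ![1, 0, 0])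
      (hR ![0, 1, 0])) (hR ![0, 0, 1])) I)) r using 1
    ext i j <;> fin_cases i <;> fin_cases j <;> simp [pauli] <;> grind
  have hfst (M : Matrix (Fin 2) (Fin 2) K) :
      ((M, 0) : Matrix (Fin 2) (Fin 2) K × Matrix (Fin 2) (Fin 2) K) ∈ R := by
    convert add_mem (R.smul_mem h1 (r * (M 0 0 + M 1 1))) (mul_mem h1 (hR ![r * (M 0 0 - M 1 1),
      r * (M 0 1 + M 1 0), r * I * (M 0 1 - M 1 0)])) using 1
    ext i j <;> fin_cases i <;> fin_cases j <;> simp [pauli] <;> grind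
  have hsnd (M : Matrix (Fin 2) (Fin 2) K) :
      ((0, M) : Matrix (Fin 2) (Fin 2) K × Matrix (Fin 2) (Fin 2) K) ∈ R := by
    have h1' := sub_mem (one_mem R) h1
    convert add_mem (R.smul_mem h1' (r * (M 0 0 + M 1 1))) (mul_mem h1' (hR (-![r * (M 0 0 - M 1 1),
      r * (M 0 1 + M 1 0), r * I * (M 0 1 - M 1 0)]))) using 1
    ext i j <;> fin_cases i <;> fin_cases j <;> simp [pauli] <;> grind
  refine eq_top_iff.2 fun x _ ↦ ?_
  simpa using add_mem (hfst x.1) (hsnd x.2)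

lemma exists_surjective_clifford [IsAlgClosed K] (h2 : (2 : K) ≠ 0)
    {M : Matrix (Fin 3) (Fin 3) K} (hM : M.IsSymm) (hM' : M.det ≠ 0) :
    ∃ ψ : CliffordAlgebra M.toQuadraticForm' →ₐ[K]
      Matrix (Fin 2) (Fin 2) K × Matrix (Fin 2) (Fin 2) K, Function.Surjective ψ := by
  have : Invertible (2 : K) := invertibleOfNonzero h2
  obtain ⟨I, hI⟩ := IsAlgClosed.exists_eq_mul_self (-1 : K)
  obtain ⟨e⟩ := toQuadraticForm'_equivalent hM (isSymm_one (n := Fin 3)) hM' (by simp)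
  have he (x : Fin 3 → K) :
      pauli I (e x) * pauli I (e x) = algebraMap K _ (M.toQuadraticForm' x) := by
    rw [← e.map_app, toQuadraticForm'_apply, one_mulVec, vec3_dotProduct,
      Algebra.algebraMap_eq_smul_one]
    ext i j <;> fin_cases i <;> fin_cases j <;> simp [pauli] <;> grind
  refine ⟨CliffordAlgebra.lift _ ⟨pauli I ∘ₗ e.toLinearEquiv.toLinearMap, he⟩,
    AlgHom.range_eq_top _ |>.1 (pauli_generates h2 hI.symm fun x ↦ ?_)⟩
  refine ⟨CliffordAlgebra.ι _ (e.symm x), (CliffordAlgebra.lift_ι_apply _ _ _).trans ?_⟩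
  exact congrArg (pauli I) (e.toLinearEquiv.apply_symm_apply x)

end Surjections

section Iso

open Matrix

/-- The isomorphism of `3 × 3` matrices over `2 × 2` matrices with `6 × 6` matrices. -/
def matrixThreeTwo (K : Type) [Field K] :
    Matrix (Fin 3) (Fin 3) (Matrix (Fin 2) (Fin 2) K) ≃ₐ[K] Matrix (Fin 6) (Fin 6) K :=
  (compAlgEquiv (Fin 3) (Fin 2) K K).trans (reindexAlgEquiv K K finProdFinEquiv)

lemma exists_surjective_matrix_prod {K C : Type} [Field K] [Ring C] [Algebra K C]
    {ψ : C →ₐ[K] Matrix (Fin 2) (Fin 2) K × Matrix (Fin 2) (Fin 2) K}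
    (hψ : Function.Surjective ψ) :
    ∃ φ : Matrix (Fin 3) (Fin 3) C →ₐ[K] Matrix (Fin 6) (Fin 6) K × Matrix (Fin 6) (Fin 6) K,
      Function.Surjective φ := by
  let χ : Matrix (Fin 3) (Fin 3) C →ₐ[K] Matrix (Fin 3) (Fin 3) (Matrix (Fin 2) (Fin 2) K) ×
      Matrix (Fin 3) (Fin 3) (Matrix (Fin 2) (Fin 2) K) :=
    ((AlgHom.fst K _ _).comp ψ).mapMatrix.prod ((AlgHom.snd K _ _).comp ψ).mapMatrix
  have hχ : Function.Surjective χ := fun x ↦ by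
    choose f hf using hψ
    refine ⟨of fun i j ↦ f (x.1 i j, x.2 i j), Prod.ext ?_ ?_⟩ <;> ext <;> simp [χ, hf]
  let e := matrixThreeTwo K
  exact ⟨(e.prodCongr e).toAlgHom.comp χ, (e.prodCongr e).surjective.comp hχ⟩

variable {K : Type} [Field K] {α1 α2 α3 : K}

lemma nonempty_algEquiv_of_surjective
    {φ : TAlg3 K α1 α2 α3 →ₐ[K] Matrix (Fin 6) (Fin 6) K × Matrix (Fin 6) (Fin 6) K}
    (hφ : Function.Surjective φ) :
    Nonempty (TAlg3 K α1 α2 α3 ≃ₐ[K] Matrix (Fin 6) (Fin 6) K × Matrix (Fin 6) (Fin 6) K) := by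
  obtain ⟨_, h⟩ := finite_and_finrank_le K α1 α2 α3
  have h' := LinearMap.finrank_le_finrank_of_surjective (f := φ.toLinearMap) hφ
  have h6 : Module.finrank K (Matrix (Fin 6) (Fin 6) K × Matrix (Fin 6) (Fin 6) K) = 72 := by
    simp [Module.finrank_prod, Module.finrank_matrix]
  have hinj : Function.Injective φ.toLinearMap :=
    (LinearMap.injective_iff_surjective_of_finrank_eq_finrank (by omega)).2 hφ
  exact ⟨AlgEquiv.ofBijective φ ⟨hinj, hφ⟩⟩

lemma exists_mul_mul_eq_self {R : Type} [Ring R] [IsSemisimpleRing R] (x : R) :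
    ∃ q, x * q * x = x := by
  obtain ⟨e, he, h⟩ := IsSemisimpleRing.ideal_eq_span_idempotent (Ideal.span {x})
  obtain ⟨q, hq⟩ : ∃ q, q * x = e := Ideal.mem_span_singleton'.1 <|
    h ▸ Ideal.mem_span_singleton_self e
  obtain ⟨t, ht⟩ : ∃ t, t * e = x := Ideal.mem_span_singleton'.1 <|
    h ▸ Ideal.mem_span_singleton_self x
  refine ⟨q, ?_⟩
  rw [mul_assoc, hq, ← ht, mul_assoc, he.eq]

lemma not_isSemisimpleRing_of_surjective {n : Type} [Fintype n] [DecidableEq n] [Nonempty n]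
    {R C : Type} [Ring R] [Ring C]
    {φ : R →+* Matrix n n C} (hφ : Function.Surjective φ) {x : C} (hx : x ≠ 0)
    (h : ∀ c, x * c * x = 0) : ¬ IsSemisimpleRing R := by
  intro _
  obtain ⟨i⟩ := ‹Nonempty n›
  obtain ⟨z, hz⟩ := hφ (single i i x)
  obtain ⟨q, hq⟩ := exists_mul_mul_eq_self z
  have h' := congrArg (fun M ↦ φ M i i) hq
  simp [hz, h] at h'
  exact hx h'.symm

lemma exists_root (K : Type) [Field K] [IsAlgClosed K] (h2 : (2 : K) ≠ 0) :
    ∃ ω : K, ω ^ 2 + ω + 1 = 0 := by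
  obtain ⟨s, hs⟩ := IsAlgClosed.exists_eq_mul_self (-3 : K)
  refine ⟨(s - 1) / 2, ?_⟩
  field_simp
  linear_combination -hs

lemma exists_params [IsAlgClosed K] (h3 : (3 : K) ≠ 0) (hα3 : α3 ≠ 0) (k : K) {ω : K}
    (hω : ω ^ 2 + ω + 1 = 0) :
    ∃ θ : K, θ ^ 3 = α3 ∧ k + ω ^ 2 * θ ≠ 0 ∧ k + θ ≠ 0 := by
  have hω3 : ω ^ 3 = 1 := by grind
  by_cases hk : α3 + k ^ 3 = 0
  · have hk0 : k ≠ 0 := by grind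
    have h1 : 1 - ω ≠ 0 := by grind
    have h2 : 1 - ω ^ 2 ≠ 0 := by grind
    refine ⟨-k * ω ^ 2, by grind, ?_, ?_⟩
    · convert mul_ne_zero hk0 h1 using 1
      grind
    · convert mul_ne_zero hk0 h2 using 1
      ring
  · obtain ⟨θ, hθ⟩ := IsAlgClosed.exists_pow_nat_eq α3 (n := 3) (by norm_num)
    exact ⟨θ, hθ, by grind, by grind⟩

end Iso

section Nilpotent

open Matrix

variable {K : Type} [Field K]

lemma exists_mul_yElt_eq {α1 α2 α3 : K} {x : TAlg3 K α1 α2 α3} :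
    ∃ x', x * yElt α2 (T3a K α1 α2 α3) (T3b K α1 α2 α3) (T3c K α1 α2 α3) =
      yElt α2 (T3a K α1 α2 α3) (T3b K α1 α2 α3) (T3c K α1 α2 α3) * x' := by
  have h := relations K α1 α2 α3
  set y := yElt α2 (T3a K α1 α2 α3) (T3b K α1 α2 α3) (T3c K α1 α2 α3)
  have hx : x ∈ Algebra.adjoin K {T3a K α1 α2 α3, T3b K α1 α2 α3, T3c K α1 α2 α3,
    T3d K α1 α2 α3} := by simp [adjoin_generators]
  induction hx using Algebra.adjoin_induction with
  | mem x hx =>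
    rcases hx with rfl | rfl | rfl | rfl
    · exact ⟨_, h.a_mul_yElt⟩
    · exact ⟨_, h.b_mul_yElt⟩
    · exact ⟨_, h.c_mul_yElt⟩
    · exact ⟨_, h.d_mul_yElt⟩
  | algebraMap r => exact ⟨_, Algebra.commutes r y⟩
  | add u v _ _ hu hv =>
    obtain ⟨u', hu⟩ := hu
    obtain ⟨v', hv⟩ := hv
    exact ⟨u' + v', by rw [add_mul, mul_add, hu, hv]⟩
  | mul u v _ _ hu hv =>
    obtain ⟨u', hu⟩ := hu
    obtain ⟨v', hv⟩ := hv
    exact ⟨u' * v', by rw [mul_assoc, hv, ← mul_assoc, hu, mul_assoc]⟩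

lemma algebraMap_matrix_eight (t : K) : algebraMap K (Matrix (Fin 8) (Fin 8) K) t =
    !![t, 0, 0, 0, 0, 0, 0, 0;
        0, t, 0, 0, 0, 0, 0, 0;
        0, 0, t, 0, 0, 0, 0, 0;
        0, 0, 0, t, 0, 0, 0, 0;
        0, 0, 0, 0, t, 0, 0, 0;
        0, 0, 0, 0, 0, t, 0, 0;
        0, 0, 0, 0, 0, 0, t, 0;
        0, 0, 0, 0, 0, 0, 0, t] := by
  rw [Algebra.algebraMap_eq_smul_one]
  ext i j
  fin_cases i <;> fin_cases j <;> simp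

/-! The four matrices below define an eight-dimensional representation of `𝒯(β², m, 0)` on which
the normal element `y` acts non-trivially. -/

/-- The image of `a` in the eight-dimensional representation. -/
def repA (β m : K) : Matrix (Fin 8) (Fin 8) K :=
  !![β, m - β ^ 2, m - β ^ 2, -β * m + β ^ 3, 0, 0, 0, 0;
    0, -β, 0, 3 * β ^ 2 - m, 0, 0, 0, 0;
    0, 0, -β, m - β ^ 2, 0, 0, 0, 0;
    0, 0, 0, β, 0, 0, 0, 0;
    0, 1, 0, -β, β, m - β ^ 2, 0, 0;
    0, 0, 0, 1, 0, -β, 0, 0;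
    0, 0, 0, 0, 0, 0, 0, β ^ 2;
    0, 0, 0, 0, 0, 0, 1, 0]

/-- The image of `b` in the eight-dimensional representation. -/
def repB (β m : K) : Matrix (Fin 8) (Fin 8) K :=
  !![β, m - β ^ 2, 0, 0, 0, 0, 0, 0;
    0, -β, 0, 0, 0, 0, 0, 0;
    0, 0, 0, β ^ 2, 0, 0, 0, 0;
    0, 0, 1, 0, 0, 0, 0, 0;
    0, 0, 0, 0, 0, β ^ 2, β ^ 2, -β * m;
    0, 0, 0, 0, 1, 0, β, β ^ 2;
    0, 0, 0, 0, 0, 0, -β, m - β ^ 2;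
    0, 0, 0, 0, 0, 0, 0, β]

/-- The image of `c` in the eight-dimensional representation. -/
def repC (β m : K) : Matrix (Fin 8) (Fin 8) K :=
  !![0, β ^ 2, β ^ 2, -β * m, 0, 0, 0, 0;
    1, 0, β, β ^ 2, 0, 0, 0, 0;
    0, 0, -β, m - β ^ 2, 0, 0, 0, 0;
    0, 0, 0, β, 0, 0, 0, 0;
    0, 0, -1, 0, β, m - β ^ 2, m - β ^ 2, -β * m + β ^ 3;
    0, 0, 0, 0, 0, -β, 0, 3 * β ^ 2 - m;
    0, 0, 0, 1, 0, 0, -β, m - β ^ 2;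
    0, 0, 0, 0, 0, 0, 0, β]

/-- The image of `d` in the eight-dimensional representation. -/
def repD (β m : K) : Matrix (Fin 8) (Fin 8) K :=
  !![0, m, β ^ 2, -β * m, 0, 0, 0, 0;
    0, -β, 0, 0, 0, 0, 0, 0;
    1, 0, 0, m, 0, 0, 0, 0;
    0, -1, 0, β, 0, 0, 0, 0;
    0, 0, 0, 0, 0, m, β ^ 2, -β * m;
    0, 0, 0, 0, 0, -β, 0, 0;
    0, 0, 0, 0, 1, 0, 0, m;
    0, 0, 0, 0, 0, -1, 0, β]

/-- The action of `y` in the eight-dimensional representation. -/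
lemma yElt_eight (β m : K) : yElt m (repA β m) (repB β m) (repC β m) =
    !![0, 0, 0, 0, 0, 0, 0, 0;
      0, 0, 0, 0, 0, 0, 0, 0;
      0, 0, 0, 0, 0, 0, 0, 0;
      0, 0, 0, 0, 0, 0, 0, 0;
      1, 0, 0, 0, 0, 0, 0, 0;
      0, 1, 0, 0, 0, 0, 0, 0;
      0, 0, 1, 0, 0, 0, 0, 0;
      0, 0, 0, 1, 0, 0, 0, 0] := by
  simp [yElt, repA, repB, repC, algebraMap_matrix_eight, vecCons_inj]
  repeat' apply And.intro
  all_goals first | ring1 | (ext i; fin_cases i <;> rfl)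

lemma relations_eight (β m : K) :
    Relations (β ^ 2) m 0 (repA β m) (repB β m) (repC β m) (repD β m) := by
  constructor
  case cube =>
    have h : repC β m * repB β m + repB β m * repA β m + repA β m * repC β m - algebraMap K _ m =
        yElt m (repA β m) (repB β m) (repC β m) := by rw [yElt]; abel
    rw [h, yElt_eight, pow_three]
    simp [algebraMap_matrix_eight]
    ext i
    fin_cases i <;> rfl
  all_goals
    simp [repA, repB, repC, repD, algebraMap_matrix_eight, vecCons_inj]
    repeat' apply And.intro
    all_goals ring

lemma not_isSemisimpleRing_zero [IsAlgClosed K] (α1 α2 : K) :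
    ¬ IsSemisimpleRing (TAlg3 K α1 α2 0) := by
  intro _
  obtain ⟨β, hβ⟩ := IsAlgClosed.exists_pow_nat_eq α1 (n := 2) two_pos
  subst hβ
  set y := yElt α2 (T3a K (β ^ 2) α2 0) (T3b K (β ^ 2) α2 0) (T3c K (β ^ 2) α2 0) with hy
  have hy3 : y ^ 3 = 0 := by rw [(relations K (β ^ 2) α2 0).yElt_pow, map_zero]
  obtain ⟨q, hq⟩ := exists_mul_mul_eq_self y
  obtain ⟨q', hq'⟩ : ∃ q', q * y = y * q' := exists_mul_yElt_eq
  rw [mul_assoc, hq', ← mul_assoc] at hq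
  have hy0 : y = 0 := calc
    y = y * y * q' := hq.symm
    _ = y * (y * y * q') * q' := by rw [hq, hq]
    _ = y ^ 3 * q' * q' := by noncomm_ring
    _ = 0 := by rw [hy3, zero_mul, zero_mul]
  have h := congrArg (lift (relations_eight β α2)) hy0
  simp only [hy, yElt, map_sub, map_add, map_mul, lift_a, lift_b, lift_c, AlgHom.commutes,
    map_zero] at h
  rw [← yElt, yElt_eight] at h
  simpa using congrFun₂ h 4 0

end Nilpotent

lemma not_isSemisimpleRing_of_eq_zero {K : Type} [Field K] [IsAlgClosed K] (h2 : (2 : K) ≠ 0)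
    (h3 : (3 : K) ≠ 0) {α1 α2 α3 : K} (hα3 : α3 ≠ 0)
    (h : α3 + (α1 + α2) * (3 * α1 - α2) ^ 2 = 0) : ¬ IsSemisimpleRing (TAlg3 K α1 α2 α3) := by
  have : Invertible (2 : K) := invertibleOfNonzero h2
  obtain ⟨ω, hω⟩ := exists_root K h2
  obtain ⟨θ, rfl, hκ0, hκ1⟩ := exists_params h3 hα3 (3 * α1 - α2) hω
  obtain ⟨φ, hφ⟩ := exists_surjective_matrix_clifford h2 h3 hω (ne_zero_pow three_ne_zero hα3)
    rfl rfl rfl hκ0 hκ1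
  have hdet := det_gram h2 h3 hω (α1 := α1) (α2 := α2) (θ := θ) rfl rfl rfl
  rw [h, mul_zero] at hdet
  obtain ⟨r, hr0, hr⟩ := Matrix.exists_mulVec_eq_zero_iff.2 hdet
  exact not_isSemisimpleRing_of_surjective (φ := φ.toRingHom) hφ (ι_ne_zero _ hr0)
    (ι_mul_mul_ι isSymm_gram hr)

lemma nonempty_algEquiv {K : Type} [Field K] [IsAlgClosed K] (h2 : (2 : K) ≠ 0)
    (h3 : (3 : K) ≠ 0) {α1 α2 α3 : K} (hα3 : α3 ≠ 0)
    (h : α3 + (α1 + α2) * (3 * α1 - α2) ^ 2 ≠ 0) :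
    Nonempty (TAlg3 K α1 α2 α3 ≃ₐ[K] Matrix (Fin 6) (Fin 6) K × Matrix (Fin 6) (Fin 6) K) := by
  obtain ⟨ω, hω⟩ := exists_root K h2
  obtain ⟨θ, rfl, hκ0, hκ1⟩ := exists_params h3 hα3 (3 * α1 - α2) hω
  have hθ : θ ≠ 0 := ne_zero_pow three_ne_zero hα3
  obtain ⟨φ, hφ⟩ := exists_surjective_matrix_clifford h2 h3 hω hθ rfl rfl rfl hκ0 hκ1
  have hdet := det_gram h2 h3 hω (α1 := α1) (α2 := α2) (θ := θ) rfl rfl rfl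
  have h9 : (9 : K) / 4 ≠ 0 := by
    convert pow_ne_zero 2 (div_ne_zero h3 h2) using 1
    norm_num [div_pow]
  obtain ⟨ψ, hψ⟩ := exists_surjective_clifford h2 isSymm_gram
    (hdet ▸ mul_ne_zero (mul_ne_zero (neg_ne_zero.2 h9) (pow_ne_zero 2 hθ)) h)
  obtain ⟨χ, hχ⟩ := exists_surjective_matrix_prod hψ
  exact nonempty_algEquiv_of_surjective (φ := χ.comp φ) (hχ.comp hφ)

end TAlg3

theorem TAlg3_semisimple_iff (K : Type) [Field K] [IsAlgClosed K]
    (h2 : ringChar K ≠ 2) (h3 : ringChar K ≠ 3) :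
    ∀ α1 α2 α3 : K,
      (IsSemisimpleRing (TAlg3 K α1 α2 α3) ↔
        α3 * (α3 + (α1 + α2) * (3 * α1 - α2) ^ 2) ≠ 0) ∧
      (α3 * (α3 + (α1 + α2) * (3 * α1 - α2) ^ 2) ≠ 0 →
        Nonempty (TAlg3 K α1 α2 α3 ≃ₐ[K]
          (Matrix (Fin 6) (Fin 6) K × Matrix (Fin 6) (Fin 6) K))) := by
  intro α1 α2 α3
  have h2' : (2 : K) ≠ 0 := Ring.two_ne_zero h2
  have h3' : (3 : K) ≠ 0 := fun h ↦
    h3 (CharP.ringChar_of_prime_eq_zero Nat.prime_three (by exact_mod_cast h))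
  have iso (h : α3 * (α3 + (α1 + α2) * (3 * α1 - α2) ^ 2) ≠ 0) :=
    TAlg3.nonempty_algEquiv h2' h3' (left_ne_zero_of_mul h) (right_ne_zero_of_mul h)
  refine ⟨⟨fun hs h ↦ ?_, fun h ↦ ?_⟩, iso⟩
  · rcases eq_or_ne α3 0 with rfl | hα3
    · exact TAlg3.not_isSemisimpleRing_zero α1 α2 hs
    · exact TAlg3.not_isSemisimpleRing_of_eq_zero h2' h3' hα3
        ((mul_eq_zero.1 h).resolve_left hα3) hs
  · obtain ⟨e⟩ := iso h
    exact e.symm.toRingEquiv.isSemisimpleRing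
end
end
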